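/- Let (X, μ, T) be an ergodic measure preserving system on a compact metric space and let a ∈ X be T-generic for μ along some Følner sequence Φ in ℕ. Let ℓ, m be positive integers, q = ⌈m/ℓ⌉, and let E₁, …, E_{ℓ+m}, F₁, …, F_{ℓ+m} ⊆ X be open sets such that F_j = T^{−(j−1)} F₁ for j = 1, …, ℓ+m, E_{i+(q+1)} = T^{−1} E_i for i = 1, …, ℓ+m−q−1, and (ℓ+m)·μ(F₁) + ℓ·(μ(E₁) + ⋯ + μ(E_{q+1})) > ℓ(q+1). Then, for some j ∈ {1, …, ℓ+m}, there exist x₁, x₂ ∈ X such that (a, x₁, x₂) is an (ℓ,m)-Erdős progression and (x₁, x₂) ∈ E_j × F_j. -/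

import Mathlib

open Filter MeasureTheory Topology

/-- A Følner sequence in `ℕ`. -/
def IsFolnerSeq (Φ : ℕ → Finset ℕ) : Prop :=
  (∀ N, (Φ N).Nonempty) ∧
  ∀ t : ℕ, Filter.Tendsto
    (fun N => ((Φ N ∩ (Φ N).image (fun n => t + n)).card : ℝ) / ((Φ N).card : ℝ))
    Filter.atTop (nhds 1)

/-- `a` is `T`-generic for `μ` along the Følner sequence `Φ`: the empirical measures
along orbits converge to `μ` in the weak* topology. -/
def GenericAlong {X : Type*} [TopologicalSpace X] [MeasurableSpace X]
    (T : X → X) (μ : MeasureTheory.Measure X) (a : X) (Φ : ℕ → Finset ℕ) : Prop :=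
  ∀ f : C(X, ℝ), Filter.Tendsto
    (fun N => (∑ n ∈ Φ N, f (T^[n] a)) / ((Φ N).card : ℝ))
    Filter.atTop (nhds (∫ x, f x ∂μ))

/-- `(x₀, x₁, x₂)` is an `(ℓ,m)`-Erdős progression for `T`. -/
def ErdosProg {X : Type*} [TopologicalSpace X] (T : X → X) (ℓ m : ℕ)
    (x₀ x₁ x₂ : X) : Prop :=
  ∃ n : ℕ → ℕ, StrictMono n ∧ (∀ i, 0 < n i) ∧
    Filter.Tendsto (fun i => (T^[ℓ * n i] x₀, T^[m * n i] x₁)) Filter.atTop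
      (nhds (x₁, x₂))



lemma exists_cells {X : Type*} [MetricSpace X] [CompactSpace X]
    [MeasurableSpace X] [BorelSpace X] [Nonempty X] (κ : ℝ) (hκ : 0 < κ) :
    ∃ (r : ℕ) (c : X → ℕ), Measurable c ∧ (∀ x, c x < r) ∧
      ∀ x x', c x = c x' → dist x x' < κ := by
  classical
  have hex : ∀ x : X, ∃ n, dist x (TopologicalSpace.denseSeq X n) < κ / 2 := by
    intro x
    obtain ⟨n, hn⟩ := (TopologicalSpace.denseRange_denseSeq X).exists_dist_lt x (half_pos hκ)
    exact ⟨n, hn⟩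
  have hmeas : Measurable (fun x => Nat.find (hex x)) := by
    apply measurable_find
    intro n
    exact (isOpen_lt (by fun_prop) (by fun_prop)).measurableSet
  obtain ⟨t, ht⟩ := isCompact_univ.elim_finite_subcover
    (fun n => Metric.ball (TopologicalSpace.denseSeq X n) (κ/2)) (fun n => Metric.isOpen_ball)
    (by
      intro x _
      obtain ⟨n, hn⟩ := hex x
      exact Set.mem_iUnion.2 ⟨n, hn⟩)
  refine ⟨t.sup id + 1, fun x => Nat.find (hex x), hmeas, ?_, ?_⟩
  · intro x
    have := ht (Set.mem_univ x)
    simp only [Set.mem_iUnion] at this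
    obtain ⟨n, hn, hx⟩ := this
    have h1 : Nat.find (hex x) ≤ n := Nat.find_min' _ hx
    have h2 : n ≤ t.sup id := Finset.le_sup (f := id) hn
    change Nat.find (hex x) < _
    omega
  · intro x x' h
    have h1 := Nat.find_spec (hex x)
    have h2 := Nat.find_spec (hex x')
    simp only at h
    rw [← h] at h2
    have := dist_triangle_right x x' (TopologicalSpace.denseSeq X (Nat.find (hex x)))
    linarith

lemma mean_erg {Y : Type*} [MeasurableSpace Y] {ν : Measure Y} [IsProbabilityMeasure ν]
    (τ : Y → Y) (hτ : MeasurePreserving τ ν ν) (h : Y → ℝ) (hm : Measurable h) (C : ℝ)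
    (hb : ∀ y, |h y| ≤ C)
    (hJ : ∀ J : Y → ℝ, Measurable J → MemLp J 2 ν → (∀ y, J (τ y) = J y) →
      ∫ y, h y * J y ∂ν = 0) :
    Tendsto (fun n : ℕ => ∫ y, |(∑ k ∈ Finset.range n, h (τ^[k] y)) / n| ∂ν) atTop (𝓝 0) := by
  have hL : MemLp h 2 ν := MemLp.of_bound hm.aestronglyMeasurable C (ae_of_all _ hb)
  set H : Lp ℝ 2 ν := hL.toLp h with hH
  set U : Lp ℝ 2 ν →L[ℝ] Lp ℝ 2 ν :=
    (Lp.compMeasurePreservingₗᵢ ℝ τ hτ).toContinuousLinearMap with hU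
  have hUn : ‖U‖ ≤ 1 := LinearIsometry.norm_toContinuousLinearMap_le _
  have hUa : ∀ f : Lp ℝ 2 ν, U f =ᵐ[ν] f ∘ τ := fun f =>
    Lp.coeFn_compMeasurePreserving f hτ
  have ht := ContinuousLinearMap.tendsto_birkhoffAverage_orthogonalProjection U hUn H
  set J0 := (LinearMap.eqLocus (U : Lp ℝ 2 ν →ₗ[ℝ] Lp ℝ 2 ν) (1 : Lp ℝ 2 ν →L[ℝ] Lp ℝ 2 ν)).orthogonalProjectionOnto H with hJ0
  have hfix : U (J0 : Lp ℝ 2 ν) = J0 := J0.2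
  have h0 : (J0 : Lp ℝ 2 ν) = 0 := by
    set j : Y → ℝ := ((J0 : Lp ℝ 2 ν) : Y → ℝ) with hj
    have hjm : Measurable j := (Lp.stronglyMeasurable _).measurable
    have hinv : j ∘ τ =ᵐ[ν] j := by
      have := hUa (J0 : Lp ℝ 2 ν)
      rw [hfix] at this
      exact this.symm
    have hinvn : ∀ᵐ y ∂ν, ∀ n : ℕ, j (τ^[n] y) = j y := by
      have h1 : ∀ᵐ y ∂ν, ∀ n : ℕ, j (τ (τ^[n] y)) = j (τ^[n] y) := by
        rw [ae_all_iff]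
        intro n
        exact (hτ.iterate n).quasiMeasurePreserving.ae hinv
      filter_upwards [h1] with y hy n
      induction n with
      | zero => rfl
      | succ n ih => rw [Function.iterate_succ_apply', hy, ih]
    set J : Y → ℝ := fun y => limsup (fun n => j (τ^[n] y)) atTop with hJd
    have hJm : Measurable J := Measurable.limsup fun n => hjm.comp (hτ.measurable.iterate n)
    have hJj : J =ᵐ[ν] j := by
      filter_upwards [hinvn] with y hy
      simp only [hJd, hy]
      exact limsup_const _
    have hJτ : ∀ y, J (τ y) = J y := by
      intro y
      have : (fun n => j (τ^[n] (τ y))) = (fun n => j (τ^[n] y)) ∘ (fun n => n + 1) := by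
        funext n
        simp [Function.iterate_succ_apply]
      simp only [hJd, this]
      rw [limsup, ← Filter.map_map, map_add_atTop_eq_nat, ← limsup]
    have hJL : MemLp J 2 ν := (memLp_congr_ae hJj).2 (Lp.memLp _)
    have h2 := hJ J hJm hJL hJτ
    have h3 : inner ℝ (J0 : Lp ℝ 2 ν) H = 0 := by
      rw [L2.inner_def, ← h2]
      apply integral_congr_ae
      filter_upwards [hJj, hL.coeFn_toLp] with y hy1 hy2
      rw [hy1, hH, hy2]
      simp [hj, mul_comm]
    have h4 : inner ℝ (J0 : Lp ℝ 2 ν) (J0 : Lp ℝ 2 ν) = 0 := by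
      rw [← h3]
      have := Submodule.inner_orthogonalProjectionOnto_eq_of_mem_right J0 H
      rw [← Submodule.inner_orthogonalProjectionOnto_eq_of_mem_left J0 H, ← hJ0]
      rfl
    exact inner_self_eq_zero.1 h4
  rw [h0] at ht
  have hbase : ∀ k : ℕ, ((U^[k] H : Lp ℝ 2 ν) : Y → ℝ) =ᵐ[ν] fun y => h (τ^[k] y) := by
    intro k
    induction k with
    | zero => simpa using hL.coeFn_toLp
    | succ k ih =>
      rw [Function.iterate_succ_apply']
      refine (hUa _).trans ?_
      have := hτ.quasiMeasurePreserving.ae ih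
      filter_upwards [this] with y hy
      simp only [Function.comp]
      rw [hy, ← Function.iterate_succ_apply]
  have hav : ∀ n : ℕ, ((birkhoffAverage ℝ U id n H : Lp ℝ 2 ν) : Y → ℝ) =ᵐ[ν]
      fun y => (∑ k ∈ Finset.range n, h (τ^[k] y)) / n := by
    intro n
    have h1 : ∀ᵐ y ∂ν, ∀ k, (U^[k] H : Lp ℝ 2 ν) y = h (τ^[k] y) := ae_all_iff.2 hbase
    have h2 := Lp.coeFn_smul (n : ℝ)⁻¹ (∑ k ∈ Finset.range n, U^[k] H)
    have h3 : ((∑ k ∈ Finset.range n, U^[k] H : Lp ℝ 2 ν) : Y → ℝ) =ᵐ[ν]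
        fun y => ∑ k ∈ Finset.range n, (U^[k] H : Lp ℝ 2 ν) y :=
      (Lp.coeFn_finsetSum _ _).trans (ae_of_all _ fun y => by rw [Finset.sum_apply])
    filter_upwards [h1, h2, h3] with y hy1 hy2 hy3
    rw [birkhoffAverage, birkhoffSum]
    simp only [id]
    rw [hy2, Pi.smul_apply, hy3]
    simp only [hy1, smul_eq_mul]
    rw [div_eq_inv_mul]
  have hle : ∀ n : ℕ, ∫ y, |(∑ k ∈ Finset.range n, h (τ^[k] y)) / n| ∂ν ≤
      ‖birkhoffAverage ℝ U id n H‖ := by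
    intro n
    set g : Lp ℝ 2 ν := birkhoffAverage ℝ U id n H
    have h1 : ∫ y, |(∑ k ∈ Finset.range n, h (τ^[k] y)) / n| ∂ν = ∫ y, ‖g y‖ ∂ν := by
      apply integral_congr_ae
      filter_upwards [hav n] with y hy
      rw [hy, Real.norm_eq_abs]
    rw [h1, Lp.norm_def, integral_norm_eq_lintegral_enorm (Lp.aestronglyMeasurable g),
      ← eLpNorm_one_eq_lintegral_enorm]
    apply ENNReal.toReal_mono (Lp.eLpNorm_ne_top g)
    exact eLpNorm_le_eLpNorm_of_exponent_le (by norm_num) (Lp.aestronglyMeasurable g)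
  have ht' := ht.norm
  rw [norm_zero] at ht'
  exact squeeze_zero (fun n => integral_nonneg fun y => abs_nonneg _) hle ht'

lemma mean_erg_ergodic {X : Type*} [MeasurableSpace X] {μ : Measure X} [IsProbabilityMeasure μ]
    (T : X → X) (hT : Ergodic T μ) (h : X → ℝ) (hm : Measurable h) (C : ℝ)
    (hb : ∀ y, |h y| ≤ C) :
    Tendsto (fun n : ℕ => ∫ y, |(∑ k ∈ Finset.range n, h (T^[k] y)) / n - ∫ x, h x ∂μ| ∂μ)
      atTop (𝓝 0) := by
  have hIntg : Integrable h μ := Integrable.of_bound hm.aestronglyMeasurable C (ae_of_all _ hb)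
  set c := ∫ x, h x ∂μ with hc
  have key := mean_erg T hT.toMeasurePreserving (fun y => h y - c) (hm.sub_const c) (C + |c|)
    (fun y => (abs_sub _ _).trans (by gcongr; exact hb y)) (by
      intro J hJm hJL hJT
      obtain ⟨d, hd⟩ := hT.toPreErgodic.ae_eq_const_of_ae_eq_comp hJm (funext hJT)
      have : (fun y => (h y - c) * J y) =ᵐ[μ] fun y => (h y - c) * d := by
        filter_upwards [hd] with y hy
        rw [hy]; rfl
      rw [integral_congr_ae this, integral_mul_const, integral_sub hIntg (integrable_const c)]
      simp [hc])
  refine (key.congr' ?_)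
  filter_upwards [eventually_gt_atTop 0] with n hn
  congr 1
  funext y
  congr 1
  rw [Finset.sum_sub_distrib, sub_div]
  have : (n : ℝ) ≠ 0 := by positivity
  simp
  field_simp


lemma folner_card {Φ : ℕ → Finset ℕ} (hΦ : IsFolnerSeq Φ) :
    Tendsto (fun N => ((Φ N).card : ℝ)) atTop atTop := by
  obtain ⟨hne, ht⟩ := hΦ
  rw [tendsto_atTop]
  intro b
  have h1 := ht 1
  have h2 : (1 : ℝ) - 1 / (|b| + 1) < 1 := by
    have : 0 < 1 / (|b| + 1) := by positivity
    linarith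
  filter_upwards [h1.eventually_const_lt h2] with N hN
  have hpos : (0 : ℝ) < (Φ N).card := by
    exact_mod_cast (hne N).card_pos
  have hlt : (Φ N ∩ (Φ N).image (fun n => 1 + n)).card + 1 ≤ (Φ N).card := by
    apply Nat.succ_le_of_lt
    apply Finset.card_lt_card
    refine ⟨Finset.inter_subset_left, fun h => ?_⟩
    have h3 := h ((Φ N).min'_mem (hne N))
    rw [Finset.mem_inter, Finset.mem_image] at h3
    obtain ⟨_, n, hn, hn2⟩ := h3
    have := (Φ N).min'_le n hn
    omega
  have hlt' : ((Φ N ∩ (Φ N).image (fun n => 1 + n)).card : ℝ) ≤ (Φ N).card - 1 := by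
    have : ((Φ N ∩ (Φ N).image (fun n => 1 + n)).card : ℝ) + 1 ≤ (Φ N).card := by
      exact_mod_cast hlt
    linarith
  have h4 : 1 - 1 / (|b| + 1) < 1 - 1 / ((Φ N).card : ℝ) := by
    refine hN.trans_le ?_
    rw [div_le_iff₀ hpos]
    field_simp
    exact hlt'
  have h5 : 1 / ((Φ N).card : ℝ) < 1 / (|b| + 1) := by linarith
  have h6 := (one_div_lt_one_div hpos (by positivity)).1 h5
  linarith [le_abs_self b]

lemma frequently_near {X : Type*} [MetricSpace X] [CompactSpace X]
    [MeasurableSpace X] [BorelSpace X] {T : X → X} {μ : Measure X} [IsProbabilityMeasure μ]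
    {a : X} {Φ : ℕ → Finset ℕ} (hΦ : IsFolnerSeq Φ) (ha : GenericAlong T μ a Φ)
    (x : X) (hx : x ∈ μ.support) : MapClusterPt x atTop (fun n => T^[n] a) := by
  rw [mapClusterPt_iff_frequently]
  intro s hs hnot
  obtain ⟨ε, hε, hsub⟩ := Metric.mem_nhds_iff.1 hs
  rw [eventually_atTop] at hnot
  obtain ⟨N, hN⟩ := hnot
  let f : C(X, ℝ) := ⟨fun y => max 0 (ε - dist y x), by fun_prop⟩
  have hf0 : ∀ y, 0 ≤ f y := fun y => le_max_left _ _
  have hfε : ∀ y, f y ≤ ε := fun y => max_le hε.le (by linarith [dist_nonneg (x := y) (y := x)])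
  have hfi : Integrable (fun y => f y) μ :=
    Integrable.of_bound f.continuous.measurable.aestronglyMeasurable ε
      (ae_of_all _ fun y => by rw [Real.norm_eq_abs, abs_of_nonneg (hf0 y)]; exact hfε y)
  have hpos : 0 < ∫ y, f y ∂μ := by
    rw [integral_pos_iff_support_of_nonneg hf0 hfi]
    have hb := (Measure.mem_support_iff_forall x).1 hx (Metric.ball x ε) (Metric.ball_mem_nhds x hε)
    refine hb.trans_le (measure_mono ?_)
    intro y hy
    rw [Function.mem_support]
    have : 0 < ε - dist y x := by rw [Metric.mem_ball] at hy; linarith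
    exact (lt_max_of_lt_right this).ne'
  have hz : ∀ n, N ≤ n → f (T^[n] a) = 0 := by
    intro n hn
    have : ε ≤ dist (T^[n] a) x := by
      by_contra h
      exact hN n hn (hsub (not_le.1 h))
    exact max_eq_left (by linarith)
  have hle : ∀ M, (∑ n ∈ Φ M, f (T^[n] a)) / ((Φ M).card : ℝ) ≤ (N * ε) / ((Φ M).card : ℝ) := by
    intro M
    gcongr
    calc ∑ n ∈ Φ M, f (T^[n] a) = ∑ n ∈ (Φ M).filter (· < N), f (T^[n] a) := by
          rw [Finset.sum_filter]
          apply Finset.sum_congr rfl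
          intro n _
          split_ifs with h
          · rfl
          · exact hz n (not_lt.1 h)
      _ ≤ ∑ n ∈ (Φ M).filter (· < N), ε := Finset.sum_le_sum fun n _ => hfε _
      _ = ((Φ M).filter (· < N)).card * ε := by simp
      _ ≤ N * ε := by
          gcongr
          calc ((Φ M).filter (· < N)).card ≤ (Finset.range N).card := by
                apply Finset.card_le_card
                intro n hn
                simpa using (Finset.mem_filter.1 hn).2
            _ = N := by simp
  have h2 : Tendsto (fun M => (N * ε) / ((Φ M).card : ℝ)) atTop (𝓝 0) :=
    tendsto_const_nhds.div_atTop (folner_card hΦ)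
  have := le_of_tendsto_of_tendsto' (ha f) h2 hle
  linarith

lemma omega_measure {X : Type*} [MetricSpace X] [CompactSpace X]
    [MeasurableSpace X] [BorelSpace X] {T : X → X} (hTc : Continuous T)
    {μ : Measure X} [IsProbabilityMeasure μ] (hT : MeasurePreserving T μ μ)
    {a : X} {Φ : ℕ → Finset ℕ} (hΦ : IsFolnerSeq Φ) (ha : GenericAlong T μ a Φ)
    (ℓ : ℕ) (hℓ : 0 < ℓ) :
    ∃ Ω : Set X, MeasurableSet Ω ∧ 1 ≤ ℓ * μ.real Ω ∧
      ∀ x ∈ Ω, MapClusterPt x atTop (fun n => T^[ℓ * n] a) := by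
  refine ⟨{x | MapClusterPt x atTop (fun n => T^[ℓ * n] a)},
    (isClosed_setOfPred_clusterPt).measurableSet, ?_, fun x hx => hx⟩
  set Ω := {x | MapClusterPt x atTop (fun n => T^[ℓ * n] a)} with hΩd
  have hΩm : MeasurableSet Ω := (isClosed_setOfPred_clusterPt).measurableSet
  have hcov : ∀ᵐ x ∂μ, x ∈ ⋃ r ∈ Finset.range ℓ, T^[r] ⁻¹' Ω := by
    filter_upwards [Measure.support_mem_ae (μ := μ)] with x hx
    have hcl := frequently_near hΦ ha x hx
    by_contra hcon
    simp only [Set.mem_iUnion, not_exists, Finset.mem_range, Set.mem_preimage, hΩd,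
      Set.mem_ofPred_eq, mapClusterPt_iff_frequently, not_forall, not_frequently] at hcon
    have hcon' : ∀ r, ∃ s ∈ 𝓝 (T^[r] x), r < ℓ → ∀ᶠ n in atTop, T^[ℓ * n] a ∉ s := by
      intro r
      by_cases h : r < ℓ
      · obtain ⟨s, hs, h2⟩ := hcon r h
        exact ⟨s, hs, fun _ => h2⟩
      · exact ⟨Set.univ, univ_mem, fun h' => absurd h' h⟩
    choose s hs hs2 using hcon'
    have hall : ∀ᶠ n in atTop, ∀ r ∈ Finset.range ℓ, T^[ℓ * n] a ∉ s r := by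
      rw [Filter.eventually_all_finset]
      intro r hr
      exact hs2 r (Finset.mem_range.1 hr)
    obtain ⟨N, hN⟩ := eventually_atTop.1 hall
    have hU : (⋂ r ∈ Finset.range ℓ, T^[r] ⁻¹' s r) ∈ 𝓝 x := by
      rw [Filter.biInter_finset_mem]
      intro r _
      exact (hTc.iterate r).continuousAt (hs r)
    have hfr := (mapClusterPt_iff_frequently.1 hcl _ hU).and_eventually (eventually_ge_atTop (ℓ * N))
    obtain ⟨n, hn, hn2⟩ := hfr.exists
    obtain ⟨r, c, hr, hrc⟩ : ∃ r c, r < ℓ ∧ r + n = ℓ * c := by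
      refine ⟨(ℓ - n % ℓ) % ℓ, ?_⟩
      have h1 : (ℓ - n % ℓ) % ℓ < ℓ := Nat.mod_lt _ hℓ
      have h2 : ((ℓ - n % ℓ) % ℓ + n) % ℓ = 0 := by
        rw [Nat.mod_add_mod, ← Nat.add_mod_mod, Nat.sub_add_cancel (Nat.mod_lt _ hℓ).le, Nat.mod_self]
      exact ⟨_, h1, (Nat.mul_div_cancel' (Nat.dvd_of_mod_eq_zero h2)).symm⟩
    have hc : N ≤ c := by
      have : ℓ * N ≤ ℓ * c := by omega
      exact Nat.le_of_mul_le_mul_left this hℓ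
    have := Set.mem_iInter₂.1 hn r (Finset.mem_range.2 hr)
    rw [Set.mem_preimage, ← Function.iterate_add_apply, hrc] at this
    exact hN c hc r (Finset.mem_range.2 hr) this
  have h1 : μ (⋃ r ∈ Finset.range ℓ, T^[r] ⁻¹' Ω) = 1 := by
    rw [← measure_univ (μ := μ)]
    apply measure_congr
    filter_upwards [hcov] with x hx
    exact propext ⟨fun _ => trivial, fun _ => hx⟩
  have h2 : (1 : ENNReal) ≤ ∑ r ∈ Finset.range ℓ, μ (T^[r] ⁻¹' Ω) := by
    rw [← h1]; exact measure_biUnion_finset_le _ _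
  simp only [(hT.iterate _).measure_preimage hΩm.nullMeasurableSet] at h2
  simp only [Finset.sum_const, Finset.card_range, nsmul_eq_mul] at h2
  have h3 := ENNReal.toReal_mono (by finiteness) h2
  rw [ENNReal.toReal_mul] at h3
  simpa [Measure.real] using h3


/-- A totally bounded (in measure) invariant measurable pseudometric bounded by one. -/
structure GoodPM {X : Type*} [MeasurableSpace X] (T : X → X) (μ : Measure X)
    (ρ : X → X → ℝ) : Prop where
  meas : Measurable (fun p : X × X => ρ p.1 p.2)
  nonneg : ∀ x y, 0 ≤ ρ x y
  le_one : ∀ x y, ρ x y ≤ 1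
  symm : ∀ x y, ρ x y = ρ y x
  tri : ∀ x y z, ρ x z ≤ ρ x y + ρ y z
  inv : ∀ x y, ρ (T x) (T y) = ρ x y
  tb : ∀ ε : ℝ, 0 < ε → ∃ (N : ℕ) (c : X → ℕ) (G : Set X), Measurable c ∧ MeasurableSet G ∧
    (∀ x, c x < N) ∧ μ.real Gᶜ ≤ ε ∧ ∀ x ∈ G, ∀ x' ∈ G, c x = c x' → ρ x x' ≤ ε

section good
variable {X : Type*} [MeasurableSpace X] {T : X → X} {μ : Measure X}

lemma GoodPM.zero : GoodPM T μ (fun _ _ => 0) where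
  meas := measurable_const
  nonneg := fun _ _ => le_rfl
  le_one := fun _ _ => zero_le_one
  symm := fun _ _ => rfl
  tri := fun _ _ _ => by simp
  inv := fun _ _ => rfl
  tb := fun ε hε => ⟨1, fun _ => 0, Set.univ, measurable_const, MeasurableSet.univ,
    fun _ => Nat.zero_lt_one, by simpa using hε.le, fun _ _ _ _ _ => hε.le⟩

lemma GoodPM.sup [IsProbabilityMeasure μ] {ρ σ : X → X → ℝ} (hρ : GoodPM T μ ρ)
    (hσ : GoodPM T μ σ) :
    GoodPM T μ (fun x y => max (ρ x y) (σ x y)) where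
  meas := hρ.meas.max hσ.meas
  nonneg := fun x y => le_max_of_le_left (hρ.nonneg x y)
  le_one := fun x y => max_le (hρ.le_one x y) (hσ.le_one x y)
  symm := fun x y => by rw [hρ.symm, hσ.symm]
  tri := fun x y z => max_le
    ((hρ.tri x y z).trans (add_le_add (le_max_left _ _) (le_max_left _ _)))
    ((hσ.tri x y z).trans (add_le_add (le_max_right _ _) (le_max_right _ _)))
  inv := fun x y => by rw [hρ.inv, hσ.inv]
  tb := fun ε hε => by
    obtain ⟨N, c, G, hc, hG, hcN, hμ, h⟩ := hρ.tb (ε / 2) (half_pos hε)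
    obtain ⟨N', c', G', hc', hG', hcN', hμ', h'⟩ := hσ.tb (ε / 2) (half_pos hε)
    refine ⟨N * N', fun x => c x * N' + c' x, G ∩ G', ?_, hG.inter hG', ?_, ?_, ?_⟩
    · exact (hc.mul_const _).add hc'
    · intro x
      have h1 := hcN x
      have h2 := hcN' x
      calc c x * N' + c' x < c x * N' + N' := by omega
        _ = (c x + 1) * N' := by ring
        _ ≤ N * N' := Nat.mul_le_mul_right _ h1
    · rw [Set.compl_inter]
      exact (measureReal_union_le _ _).trans (by linarith)
    · intro x hx x' hx' hxx
      have hN' : 0 < N' := (Nat.zero_le _).trans_lt (hcN' x)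
      have h1 : c x = c x' := by
        have := congrArg (fun n => n / N') hxx
        simp only [Nat.add_comm (_ * N'), Nat.add_mul_div_right _ _ hN',
          Nat.div_eq_of_lt (hcN' _), Nat.zero_add] at this
        exact this
      have h2 : c' x = c' x' := by
        simp only [h1] at hxx
        omega
      exact max_le ((h x hx.1 x' hx'.1 h1).trans (by linarith))
        ((h' x hx.2 x' hx'.2 h2).trans (by linarith))

lemma GoodPM.scale {ρ : X → X → ℝ} (hρ : GoodPM T μ ρ) (N : ℕ) :
    GoodPM T μ (fun x y => min 1 (N * ρ x y)) where
  meas := measurable_const.min (hρ.meas.const_mul _)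
  nonneg := fun x y => le_min zero_le_one (mul_nonneg (Nat.cast_nonneg _) (hρ.nonneg x y))
  le_one := fun x y => min_le_left _ _
  symm := fun x y => by rw [hρ.symm]
  tri := fun x y z => by
    have h1 := mul_le_mul_of_nonneg_left (hρ.tri x y z) (Nat.cast_nonneg (α := ℝ) N)
    have h2 := mul_nonneg (Nat.cast_nonneg (α := ℝ) N) (hρ.nonneg x y)
    have h3 := mul_nonneg (Nat.cast_nonneg (α := ℝ) N) (hρ.nonneg y z)
    rw [mul_add] at h1
    rcases min_cases 1 ((N : ℝ) * ρ x z) with ⟨h, _⟩ | ⟨h, _⟩ <;>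
    rcases min_cases 1 ((N : ℝ) * ρ x y) with ⟨h', _⟩ | ⟨h', _⟩ <;>
    rcases min_cases 1 ((N : ℝ) * ρ y z) with ⟨h'', _⟩ | ⟨h'', _⟩ <;> rw [h, h', h''] <;> linarith
  inv := fun x y => by rw [hρ.inv]
  tb := fun ε hε => by
    obtain ⟨M, c, G, hc, hG, hcN, hμ, h⟩ := hρ.tb (ε / (N + 1)) (by positivity)
    refine ⟨M, c, G, hc, hG, hcN, hμ.trans (div_le_self hε.le (by simp)), ?_⟩
    intro x hx x' hx' hxx
    refine (min_le_right _ _).trans ?_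
    have := h x hx x' hx' hxx
    calc (N : ℝ) * ρ x x' ≤ (N + 1) * (ε / (N + 1)) := by
          gcongr
          · exact hρ.nonneg _ _
          · linarith
      _ = ε := by field_simp

lemma GoodPM.finite_sup [IsProbabilityMeasure μ] (ρ : ℕ → X → X → ℝ)
    (hρ : ∀ n, GoodPM T μ (ρ n)) (N : ℕ) :
    ∃ σ, GoodPM T μ σ ∧ ∀ n < N, ∀ x y, ρ n x y ≤ σ x y := by
  induction N with
  | zero => exact ⟨_, GoodPM.zero, by simp⟩
  | succ N ih =>
    obtain ⟨σ, hσ, h⟩ := ih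
    refine ⟨_, hσ.sup (hρ N), fun n hn x y => ?_⟩
    rcases Nat.lt_succ_iff_lt_or_eq.1 hn with h1 | h1
    · exact (h n h1 x y).trans (le_max_left _ _)
    · rw [h1]; exact le_max_right _ _

lemma GoodPM.abs_sub_le {ρ : X → X → ℝ} (hρ : GoodPM T μ ρ) (x x' y : X) :
    |ρ x y - ρ x' y| ≤ ρ x x' := by
  rw [_root_.abs_le]
  have h1 := hρ.tri x x' y
  have h2 := hρ.tri x' x y
  rw [hρ.symm x' x] at h2
  constructor <;> linarith

/-- density of a pseudometric -/
noncomputable def dens (μ : Measure X) (ρ : X → X → ℝ) : ℝ :=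
  ∫ x, ∫ x', (1 - ρ x x') ∂μ ∂μ

lemma GoodPM.meas_right {ρ : X → X → ℝ} (hρ : GoodPM T μ ρ) (x : X) :
    Measurable (fun y => ρ x y) := hρ.meas.comp measurable_prodMk_left

lemma GoodPM.meas_left {ρ : X → X → ℝ} (hρ : GoodPM T μ ρ) (y : X) :
    Measurable (fun x => ρ x y) := hρ.meas.comp measurable_prodMk_right

lemma GoodPM.integrable_right [IsProbabilityMeasure μ] {ρ : X → X → ℝ} (hρ : GoodPM T μ ρ) (x : X) :
    Integrable (fun y => 1 - ρ x y) μ :=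
  Integrable.of_bound ((hρ.meas_right x).const_sub 1).aestronglyMeasurable 1 (ae_of_all _ fun y => by
    rw [Real.norm_eq_abs, abs_le]
    constructor <;> linarith [hρ.nonneg x y, hρ.le_one x y])

lemma GoodPM.row [IsProbabilityMeasure μ] {ρ : X → X → ℝ} (hρ : GoodPM T μ ρ)
    (hT : Ergodic T μ) : ∀ᵐ x ∂μ, ∫ x', (1 - ρ x x') ∂μ = dens μ ρ := by
  have hm : Measurable (fun x => ∫ x', (1 - ρ x x') ∂μ) := by
    have : StronglyMeasurable (fun p : X × X => 1 - ρ p.1 p.2) :=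
      (hρ.meas.const_sub 1).stronglyMeasurable
    exact this.integral_prod_right.measurable
  have hinv : (fun x => ∫ x', (1 - ρ x x') ∂μ) ∘ T = fun x => ∫ x', (1 - ρ x x') ∂μ := by
    funext x
    simp only [Function.comp]
    have h1 := hT.toMeasurePreserving.map_eq
    conv_lhs => rw [← h1]
    rw [integral_map hT.measurable.aemeasurable
      ((hρ.meas_right (T x)).const_sub 1).aestronglyMeasurable]
    simp only [hρ.inv]
  obtain ⟨d, hd⟩ := hT.toPreErgodic.ae_eq_const_of_ae_eq_comp hm hinv
  have hd2 : dens μ ρ = d := by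
    rw [dens, integral_congr_ae hd]
    simp
  rw [hd2]
  exact hd

lemma GoodPM.dens_pos [IsProbabilityMeasure μ] {ρ : X → X → ℝ} (hρ : GoodPM T μ ρ)
    (hT : Ergodic T μ) : 0 < dens μ ρ := by
  obtain ⟨N, c, G, hc, hG, hcN, hμ, h⟩ := hρ.tb (1 / 2) (by norm_num)
  have hex : ∃ i, μ (G ∩ c ⁻¹' {i}) ≠ 0 := by
    by_contra hcon
    push Not at hcon
    have h1 : μ (⋃ i, G ∩ c ⁻¹' {i}) = 0 := measure_iUnion_null hcon
    have h2 : G ⊆ ⋃ i, G ∩ c ⁻¹' {i} := fun x hx => Set.mem_iUnion.2 ⟨c x, hx, rfl⟩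
    have h3 : μ.real G = 0 := by
      rw [Measure.real, measure_mono_null h2 h1]; rfl
    have h4 := probReal_compl_eq_one_sub (μ := μ) hG
    linarith
  obtain ⟨i, hi⟩ := hex
  have hfreq : ∃ᵐ x ∂μ, x ∈ G ∩ c ⁻¹' {i} := frequently_ae_mem_iff.2 hi
  obtain ⟨x, hx, hxd⟩ := (hfreq.and_eventually (hρ.row hT)).exists
  rw [← hxd]
  have hA : MeasurableSet (G ∩ c ⁻¹' {i}) := hG.inter (hc (measurableSet_singleton i))
  have h5 : ∫ y in G ∩ c ⁻¹' {i}, (1 / 2 : ℝ) ∂μ ≤ ∫ y in G ∩ c ⁻¹' {i}, (1 - ρ x y) ∂μ := by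
    apply setIntegral_mono_on (integrable_const _) (hρ.integrable_right x).integrableOn hA
    intro y hy
    have := h x hx.1 y hy.1 (by rw [show c x = i from hx.2, show c y = i from hy.2])
    linarith
  have h6 : ∫ y in G ∩ c ⁻¹' {i}, (1 - ρ x y) ∂μ ≤ ∫ y, (1 - ρ x y) ∂μ :=
    setIntegral_le_integral (hρ.integrable_right x)
      (ae_of_all _ fun y => by simpa using hρ.le_one x y)
  have h7 : 0 < μ.real (G ∩ c ⁻¹' {i}) := by
    rw [measureReal_def]; exact ENNReal.toReal_pos hi (measure_ne_top _ _)
  rw [setIntegral_const, smul_eq_mul] at h5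
  linarith

end good


section sig
variable {X : Type*} [MeasurableSpace X] {T : X → X} {μ : Measure X}

/-- the weighted product measure -/
noncomputable def nuM (μ : Measure X) (ρ : X → X → ℝ) : Measure (X × X) :=
  (μ.prod μ).withDensity (fun p => ENNReal.ofReal (1 - ρ p.1 p.2))

lemma GoodPM.row_lintegral [IsProbabilityMeasure μ] {ρ : X → X → ℝ} (hρ : GoodPM T μ ρ)
    (hT : Ergodic T μ) :
    ∀ᵐ x ∂μ, ∫⁻ x', ENNReal.ofReal (1 - ρ x x') ∂μ = ENNReal.ofReal (dens μ ρ) := by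
  filter_upwards [hρ.row hT] with x hx
  rw [← hx, ofReal_integral_eq_lintegral_ofReal (hρ.integrable_right x)]
  exact ae_of_all _ fun y => by simpa using hρ.le_one x y

lemma GoodPM.nu_fst [IsProbabilityMeasure μ] {ρ : X → X → ℝ} (hρ : GoodPM T μ ρ)
    (hT : Ergodic T μ) (A : Set X) (hA : MeasurableSet A) :
    nuM μ ρ (Prod.fst ⁻¹' A) = ENNReal.ofReal (dens μ ρ) * μ A := by
  have hf : Measurable (fun p : X × X => ENNReal.ofReal (1 - ρ p.1 p.2)) :=
    (hρ.meas.const_sub 1).ennreal_ofReal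
  rw [nuM, withDensity_apply _ (measurable_fst hA), ← Set.prod_univ, ← Measure.prod_restrict,
    lintegral_prod _ hf.aemeasurable]
  simp only [Measure.restrict_univ]
  rw [lintegral_congr_ae (ae_restrict_of_ae (hρ.row_lintegral hT))]
  simp

lemma GoodPM.nu_snd [IsProbabilityMeasure μ] {ρ : X → X → ℝ} (hρ : GoodPM T μ ρ)
    (hT : Ergodic T μ) (A : Set X) (hA : MeasurableSet A) :
    nuM μ ρ (Prod.snd ⁻¹' A) = ENNReal.ofReal (dens μ ρ) * μ A := by
  have hf : Measurable (fun p : X × X => ENNReal.ofReal (1 - ρ p.1 p.2)) :=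
    (hρ.meas.const_sub 1).ennreal_ofReal
  rw [nuM, withDensity_apply _ (measurable_snd hA), ← Set.univ_prod, ← Measure.prod_restrict,
    lintegral_prod_symm _ hf.aemeasurable]
  simp only [Measure.restrict_univ]
  have h : ∀ᵐ x ∂μ, ∫⁻ x', ENNReal.ofReal (1 - ρ x' x) ∂μ = ENNReal.ofReal (dens μ ρ) := by
    filter_upwards [hρ.row_lintegral hT] with x hx
    rw [← hx]
    simp only [hρ.symm _ x]
  rw [lintegral_congr_ae (ae_restrict_of_ae h)]
  simp

lemma GoodPM.nu_univ [IsProbabilityMeasure μ] {ρ : X → X → ℝ} (hρ : GoodPM T μ ρ)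
    (hT : Ergodic T μ) : nuM μ ρ Set.univ = ENNReal.ofReal (dens μ ρ) := by
  have := hρ.nu_fst hT Set.univ MeasurableSet.univ
  simpa using this

lemma GoodPM.nu_finite [IsProbabilityMeasure μ] {ρ : X → X → ℝ} (hρ : GoodPM T μ ρ)
    (hT : Ergodic T μ) : IsFiniteMeasure (nuM μ ρ) :=
  ⟨by rw [hρ.nu_univ hT]; exact ENNReal.ofReal_lt_top⟩

lemma GoodPM.nu_fst_real [IsProbabilityMeasure μ] {ρ : X → X → ℝ} (hρ : GoodPM T μ ρ)
    (hT : Ergodic T μ) (A : Set X) (hA : MeasurableSet A) :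
    (nuM μ ρ).real (Prod.fst ⁻¹' A) = dens μ ρ * μ.real A := by
  rw [measureReal_def, hρ.nu_fst hT A hA, ENNReal.toReal_mul,
    ENNReal.toReal_ofReal (hρ.dens_pos hT).le, measureReal_def]

lemma GoodPM.nu_snd_real [IsProbabilityMeasure μ] {ρ : X → X → ℝ} (hρ : GoodPM T μ ρ)
    (hT : Ergodic T μ) (A : Set X) (hA : MeasurableSet A) :
    (nuM μ ρ).real (Prod.snd ⁻¹' A) = dens μ ρ * μ.real A := by
  rw [measureReal_def, hρ.nu_snd hT A hA, ENNReal.toReal_mul,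
    ENNReal.toReal_ofReal (hρ.dens_pos hT).le, measureReal_def]

/-- pairs separated by a set -/
def sepSet (A : Set X) : Set (X × X) := {p | ¬ (p.1 ∈ A ↔ p.2 ∈ A)}

/-- asymptotically invariant sets -/
def AsymInv (T : X → X) (μ : Measure X) (A : Set X) : Prop :=
  ∀ η : ℝ, 0 < η → ∃ ρ₀, GoodPM T μ ρ₀ ∧ ∀ ρ, GoodPM T μ ρ → (∀ x y, ρ₀ x y ≤ ρ x y) →
    (nuM μ ρ).real (sepSet A) ≤ η * dens μ ρ

/-- the sigma algebra -/
def Bsig [IsProbabilityMeasure μ] (hT : Ergodic T μ) : MeasurableSpace X where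
  MeasurableSet' A := MeasurableSet A ∧ AsymInv T μ A
  measurableSet_empty := ⟨MeasurableSet.empty, fun η hη => ⟨_, GoodPM.zero, fun ρ hρ _ => by
    have : sepSet (∅ : Set X) = ∅ := by ext p; simp [sepSet]
    rw [this, measureReal_empty]
    exact mul_nonneg hη.le (hρ.dens_pos hT).le⟩⟩
  measurableSet_compl A hA := ⟨hA.1.compl, by
    have : sepSet Aᶜ = sepSet A := by ext p; simp [sepSet]; tauto
    intro η hη
    rw [this]
    exact hA.2 η hη⟩
  measurableSet_iUnion A hA := ⟨MeasurableSet.iUnion fun n => (hA n).1, by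
    intro η hη
    have hR : ∃ N : ℕ, μ.real ((⋃ n, A n) \ ⋃ n ∈ Finset.range N, A n) ≤ η / 4 := by
      have hanti : Antitone (fun N : ℕ => (⋃ n, A n) \ ⋃ n ∈ Finset.range N, A n) := by
        intro N M hNM
        apply Set.sdiff_subset_sdiff_right
        apply Set.biUnion_subset_biUnion_left
        intro n hn
        simp only [Finset.coe_range, Finset.mem_coe, Finset.mem_range, Set.mem_Iio] at *
        omega
      have ht := tendsto_measure_iInter_atTop (μ := μ)
        (s := fun N : ℕ => (⋃ n, A n) \ ⋃ n ∈ Finset.range N, A n)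
        (fun N => ((MeasurableSet.iUnion fun n => (hA n).1).diff
          (Finset.measurableSet_biUnion _ fun n _ => (hA n).1)).nullMeasurableSet) hanti
        ⟨0, measure_ne_top _ _⟩
      have he : (⋂ N : ℕ, (⋃ n, A n) \ ⋃ n ∈ Finset.range N, A n) = ∅ := by
        ext x
        simp only [Set.mem_iInter, Set.mem_sdiff, Set.mem_iUnion, Set.mem_empty_iff_false, iff_false]
        intro h
        obtain ⟨n, hn⟩ := (h 0).1
        exact (h (n + 1)).2 ⟨n, Finset.mem_range.2 (Nat.lt_succ_self n), hn⟩
      rw [he, measure_empty] at ht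
      have ht2 := (ENNReal.tendsto_toReal ENNReal.zero_ne_top).comp ht
      obtain ⟨N, hN⟩ := (ht2.eventually_le_const (show (0 : ENNReal).toReal < η / 4 by
        simp; linarith)).exists
      exact ⟨N, hN⟩
    obtain ⟨N, hN⟩ := hR
    have hη' : 0 < η / (2 * (N + 1)) := by positivity
    choose ρs hρs hs using fun n => (hA n).2 _ hη'
    obtain ⟨σ, hσ, hσ2⟩ := GoodPM.finite_sup ρs hρs N
    refine ⟨σ, hσ, fun ρ hρ hle => ?_⟩
    have := hρ.nu_finite hT
    set R := (⋃ n, A n) \ ⋃ n ∈ Finset.range N, A n with hRd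
    have hRm : MeasurableSet R := ((MeasurableSet.iUnion fun n => (hA n).1).diff
          (Finset.measurableSet_biUnion _ fun n _ => (hA n).1))
    have hsub : sepSet (⋃ n, A n) ⊆ (⋃ n ∈ Finset.range N, sepSet (A n)) ∪
        (Prod.fst ⁻¹' R ∪ Prod.snd ⁻¹' R) := by
      intro p hp
      by_contra hcon
      simp only [Set.mem_union, not_or] at hcon
      obtain ⟨h1, h2, h3⟩ := hcon
      have h1' : ∀ n < N, (p.1 ∈ A n ↔ p.2 ∈ A n) := by
        intro n hn
        by_contra hh
        exact h1 (Set.mem_iUnion₂.2 ⟨n, Finset.mem_range.2 hn, hh⟩)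
      apply hp
      have key : ∀ x : X, x ∉ R → (x ∈ ⋃ n, A n) → ∃ n < N, x ∈ A n := by
        intro x hx hx2
        by_contra hh
        apply hx
        refine ⟨hx2, fun h => ?_⟩
        obtain ⟨n, hn, hn2⟩ := Set.mem_iUnion₂.1 h
        exact hh ⟨n, Finset.mem_range.1 hn, hn2⟩
      constructor
      · intro h
        obtain ⟨n, hn, hn2⟩ := key p.1 h2 h
        exact Set.mem_iUnion.2 ⟨n, (h1' n hn).1 hn2⟩
      · intro h
        obtain ⟨n, hn, hn2⟩ := key p.2 h3 h
        exact Set.mem_iUnion.2 ⟨n, (h1' n hn).2 hn2⟩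
    have hd := hρ.dens_pos hT
    calc (nuM μ ρ).real (sepSet (⋃ n, A n))
        ≤ (nuM μ ρ).real (⋃ n ∈ Finset.range N, sepSet (A n)) +
          ((nuM μ ρ).real (Prod.fst ⁻¹' R) + (nuM μ ρ).real (Prod.snd ⁻¹' R)) :=
          (measureReal_mono hsub).trans ((measureReal_union_le _ _).trans
            (by gcongr; exact measureReal_union_le _ _))
      _ ≤ (∑ n ∈ Finset.range N, (nuM μ ρ).real (sepSet (A n))) +
          (dens μ ρ * (η / 4) + dens μ ρ * (η / 4)) := by
          rw [hρ.nu_fst_real hT R hRm, hρ.nu_snd_real hT R hRm]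
          gcongr
          exact measureReal_biUnion_finset_le _ _
      _ ≤ (∑ n ∈ Finset.range N, (η / (2 * (N + 1))) * dens μ ρ) +
          (dens μ ρ * (η / 4) + dens μ ρ * (η / 4)) := by
          gcongr with n hn
          exact hs n ρ hρ fun x y => (hσ2 n (Finset.mem_range.1 hn) x y).trans (hle x y)
      _ = (η / 2) * ((N / (N + 1)) * dens μ ρ) + η / 2 * dens μ ρ := by
          rw [Finset.sum_const, Finset.card_range, nsmul_eq_mul]
          field_simp
          ring
      _ ≤ (η / 2) * (1 * dens μ ρ) + η / 2 * dens μ ρ := by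
          gcongr
          rw [div_le_one (by positivity)]
          linarith
      _ = η * dens μ ρ := by ring⟩

lemma Bsig_le [IsProbabilityMeasure μ] (hT : Ergodic T μ) :
    Bsig hT ≤ ‹MeasurableSpace X› := fun _ hA => hA.1

lemma lip_meas [IsProbabilityMeasure μ] (hT : Ergodic T μ) (g : X → ℝ) (hg : Measurable g)
    (ρ₀ : X → X → ℝ) (hρ₀ : GoodPM T μ ρ₀) (X1 : Set X) (hX1m : MeasurableSet X1)
    (hX1 : μ X1ᶜ = 0)
    (hlip : ∀ x ∈ X1, ∀ x' ∈ X1, ρ₀ x x' < 1 → |g x - g x'| ≤ ρ₀ x x') :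
    Measurable[Bsig hT] g := by
  refine measurable_of_Ioi (mδ := Bsig hT) (α := ℝ) fun t => ?_
  refine ⟨hg measurableSet_Ioi, fun η hη => ?_⟩
  have hR : ∃ N : ℕ, μ.real (g ⁻¹' Set.Ioo t (t + 1 / ((N : ℝ) + 1))) ≤ η / 2 := by
    have hanti : Antitone (fun N : ℕ => g ⁻¹' Set.Ioo t (t + 1 / ((N : ℝ) + 1))) := by
      intro N M hNM
      apply Set.preimage_mono
      apply Set.Ioo_subset_Ioo_right
      have := Nat.one_div_le_one_div (α := ℝ) hNM
      linarith
    have ht := tendsto_measure_iInter_atTop (μ := μ)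
      (s := fun N : ℕ => g ⁻¹' Set.Ioo t (t + 1 / ((N : ℝ) + 1)))
      (fun N => (hg measurableSet_Ioo).nullMeasurableSet) hanti ⟨0, measure_ne_top _ _⟩
    have he : (⋂ N : ℕ, g ⁻¹' Set.Ioo t (t + 1 / ((N : ℝ) + 1))) = ∅ := by
      ext x
      simp only [Set.mem_iInter, Set.mem_preimage, Set.mem_Ioo, Set.mem_empty_iff_false, iff_false]
      intro h
      obtain ⟨n, hn⟩ := exists_nat_one_div_lt (sub_pos.2 (h 0).1)
      have := (h n).2
      linarith
    rw [he, measure_empty] at ht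
    have ht2 := (ENNReal.tendsto_toReal ENNReal.zero_ne_top).comp ht
    obtain ⟨N, hN⟩ := (ht2.eventually_le_const (show (0 : ENNReal).toReal < η / 2 by
      simp; linarith)).exists
    exact ⟨N, hN⟩
  obtain ⟨N, hN⟩ := hR
  refine ⟨_, hρ₀.scale (N + 1), fun ρ hρ hle => ?_⟩
  have := hρ.nu_finite hT
  set B := X1ᶜ ∪ g ⁻¹' Set.Ioo t (t + 1 / ((N : ℝ) + 1)) with hB
  have hBm : MeasurableSet B := hX1m.compl.union (hg measurableSet_Ioo)
  have hBμ : μ.real B ≤ η / 2 := by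
    refine (measureReal_union_le _ _).trans ?_
    have : μ.real X1ᶜ = 0 := by rw [measureReal_def, hX1]; rfl
    linarith
  set Z : Set (X × X) := {p | 1 ≤ ρ p.1 p.2} with hZ
  have hZm : MeasurableSet Z := measurableSet_le measurable_const hρ.meas
  have hZ0 : (nuM μ ρ).real Z = 0 := by
    rw [measureReal_def, nuM, withDensity_apply _ hZm, setLIntegral_congr_fun (g := fun _ => 0) hZm]
    · simp
    · intro p hp
      have : 1 - ρ p.1 p.2 ≤ 0 := by
        have : 1 ≤ ρ p.1 p.2 := hp
        linarith
      simp [ENNReal.ofReal_eq_zero, this]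
  have hsub : sepSet (g ⁻¹' Set.Ioi t) ⊆ Z ∪ (Prod.fst ⁻¹' B ∪ Prod.snd ⁻¹' B) := by
    intro p hp
    by_contra hcon
    simp only [Set.mem_union, not_or] at hcon
    obtain ⟨h1, h2, h3⟩ := hcon
    have h1' : ρ p.1 p.2 < 1 := not_le.1 h1
    have hp1 : p.1 ∈ X1 := by
      by_contra h; exact h2 (Or.inl h)
    have hp2 : p.2 ∈ X1 := by
      by_contra h; exact h3 (Or.inl h)
    have h4 : ((N + 1 : ℕ) : ℝ) * ρ₀ p.1 p.2 < 1 := by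
      have := (hle p.1 p.2).trans_lt h1'
      rcases min_lt_iff.1 this with h | h
      · exact absurd h (lt_irrefl _)
      · exact h
    have hN1 : (0 : ℝ) < (N : ℝ) + 1 := by positivity
    have h5 : ρ₀ p.1 p.2 < 1 / ((N : ℝ) + 1) := by
      rw [lt_div_iff₀ hN1]
      push_cast at h4
      linarith
    have h6 : 1 / ((N : ℝ) + 1) ≤ 1 := by
      rw [div_le_one hN1]; linarith [Nat.cast_nonneg (α := ℝ) N]
    have h7 := (hlip p.1 hp1 p.2 hp2 (h5.trans_le h6)).trans_lt h5
    rw [abs_lt] at h7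
    have h2' : ¬ (t < g p.1 ∧ g p.1 < t + 1 / ((N : ℝ) + 1)) := fun h => h2 (Or.inr h)
    have h3' : ¬ (t < g p.2 ∧ g p.2 < t + 1 / ((N : ℝ) + 1)) := fun h => h3 (Or.inr h)
    apply hp
    simp only [Set.mem_preimage, Set.mem_Ioi]
    constructor
    · intro h
      by_contra hh
      exact h2' ⟨h, by linarith⟩
    · intro h
      by_contra hh
      exact h3' ⟨h, by linarith⟩
  have hd := hρ.dens_pos hT
  calc (nuM μ ρ).real (sepSet (g ⁻¹' Set.Ioi t))
      ≤ (nuM μ ρ).real Z + ((nuM μ ρ).real (Prod.fst ⁻¹' B) + (nuM μ ρ).real (Prod.snd ⁻¹' B)) :=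
        (measureReal_mono hsub).trans ((measureReal_union_le _ _).trans
            (by gcongr; exact measureReal_union_le _ _))
    _ ≤ 0 + (dens μ ρ * (η / 2) + dens μ ρ * (η / 2)) := by
        rw [hρ.nu_fst_real hT B hBm, hρ.nu_snd_real hT B hBm, hZ0]
        gcongr
    _ = η * dens μ ρ := by ring

lemma concentration [IsProbabilityMeasure μ] (hT : Ergodic T μ) (k : X → ℝ)
    (hk : Measurable[Bsig hT] k) (hk0 : ∀ x, 0 ≤ k x) (hk1 : ∀ x, k x ≤ 1)
    (η : ℝ) (hη : 0 < η) :
    ∃ ρ₀, GoodPM T μ ρ₀ ∧ ∀ ρ, GoodPM T μ ρ → (∀ x y, ρ₀ x y ≤ ρ x y) →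
      ∫ x, ∫ x', (1 - ρ x x') * |k x - k x'| ∂μ ∂μ ≤ η * dens μ ρ := by
  obtain ⟨N, hN⟩ := exists_nat_one_div_lt (half_pos hη)
  have hkm : Measurable k := hk.mono (Bsig_le hT) le_rfl
  have hη' : 0 < η / (2 * (N + 2)) := by positivity
  have hAi : ∀ n : ℕ, AsymInv T μ (k ⁻¹' Set.Ici ((n : ℝ) / (N + 1))) := fun n =>
    (hk measurableSet_Ici).2
  choose ρs hρs hs using fun n => hAi n _ hη'
  obtain ⟨σ, hσ, hσ2⟩ := GoodPM.finite_sup ρs hρs (N + 2)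
  refine ⟨σ, hσ, fun ρ hρ hle => ?_⟩
  have := hρ.nu_finite hT
  have hd := hρ.dens_pos hT
  set D : Set (X × X) := ⋃ n ∈ Finset.range (N + 2), sepSet (k ⁻¹' Set.Ici ((n : ℝ) / (N + 1)))
  have hDm : MeasurableSet D := by
    apply Finset.measurableSet_biUnion
    intro n _
    have hA : MeasurableSet (k ⁻¹' Set.Ici ((n : ℝ) / (N + 1))) := hkm measurableSet_Ici
    exact ((measurable_fst hA).iff (measurable_snd hA)).compl
  have hD : (nuM μ ρ).real D ≤ η / 2 * dens μ ρ := by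
    calc (nuM μ ρ).real D ≤ ∑ n ∈ Finset.range (N + 2), _ := measureReal_biUnion_finset_le _ _
      _ ≤ ∑ n ∈ Finset.range (N + 2), η / (2 * (N + 2)) * dens μ ρ := by
        gcongr with n hn
        exact hs n ρ hρ fun x y => (hσ2 n (Finset.mem_range.1 hn) x y).trans (hle x y)
      _ = η / 2 * dens μ ρ := by
        rw [Finset.sum_const, Finset.card_range, nsmul_eq_mul]
        push_cast
        field_simp
  have hpt : ∀ p : X × X, |k p.1 - k p.2| ≤ 1 / ((N : ℝ) + 1) + D.indicator (fun _ => 1) p := by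
    intro p
    by_cases hp : p ∈ D
    · rw [Set.indicator_of_mem hp]
      have : |k p.1 - k p.2| ≤ 1 := by
        rw [abs_le]; constructor <;> linarith [hk0 p.1, hk0 p.2, hk1 p.1, hk1 p.2]
      have : 0 < 1 / ((N : ℝ) + 1) := by positivity
      linarith
    · rw [Set.indicator_of_notMem hp, add_zero]
      have hN1 : (0 : ℝ) < (N : ℝ) + 1 := by positivity
      have key : ∀ x y : X, (∀ n ∈ Finset.range (N + 2), ((n : ℝ) / (N + 1) ≤ k x ↔ (n : ℝ) / (N + 1) ≤ k y)) →
          k y - k x ≤ 1 / ((N : ℝ) + 1) := by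
        intro x y h
        by_contra hcon
        push Not at hcon
        have hx0 : 0 ≤ ((N : ℝ) + 1) * k x := mul_nonneg hN1.le (hk0 x)
        have h1 := Nat.lt_floor_add_one (((N : ℝ) + 1) * k x)
        have h2 := Nat.floor_le hx0
        have h3 : (((N : ℝ) + 1) * k x) + 1 < ((N : ℝ) + 1) * k y := by
          rw [div_lt_iff₀ hN1] at hcon
          linarith
        have h4 : ((⌊((N : ℝ) + 1) * k x⌋₊ + 1 : ℕ) : ℝ) / (N + 1) ≤ k y := by
          rw [div_le_iff₀ hN1]; push_cast; linarith
        have h5 : ¬ ((⌊((N : ℝ) + 1) * k x⌋₊ + 1 : ℕ) : ℝ) / (N + 1) ≤ k x := by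
          rw [div_le_iff₀ hN1]; push_cast; linarith
        have h6 : ⌊((N : ℝ) + 1) * k x⌋₊ + 1 < N + 2 := by
          have : ((⌊((N : ℝ) + 1) * k x⌋₊ + 1 : ℕ) : ℝ) < (N + 2 : ℕ) := by
            push_cast
            have : ((N : ℝ) + 1) * k y ≤ (N + 1) * 1 := by gcongr; exact hk1 y
            linarith
          exact_mod_cast this
        exact h5 ((h _ (Finset.mem_range.2 h6)).2 h4)
      have hall : ∀ n ∈ Finset.range (N + 2), ((n : ℝ) / (N + 1) ≤ k p.1 ↔ (n : ℝ) / (N + 1) ≤ k p.2) := by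
        intro n hn
        by_contra hh
        exact hp (Set.mem_iUnion₂.2 ⟨n, hn, hh⟩)
      rw [abs_le]
      constructor
      · linarith [key p.1 p.2 hall]
      · linarith [key p.2 p.1 fun n hn => (hall n hn).symm]
  have hconv : ∫ x, ∫ x', (1 - ρ x x') * |k x - k x'| ∂μ ∂μ = ∫ p, |k p.1 - k p.2| ∂(nuM μ ρ) := by
    have hm1 : Measurable (fun p : X × X => |k p.1 - k p.2|) := by fun_prop
    have hm2 : Measurable (fun p : X × X => (1 - ρ p.1 p.2) * |k p.1 - k p.2|) :=
      (hρ.meas.const_sub 1).mul hm1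
    rw [nuM, integral_withDensity_eq_integral_toReal_smul
      (hρ.meas.const_sub 1).ennreal_ofReal (ae_of_all _ fun _ => ENNReal.ofReal_lt_top)]
    have : ∀ p : X × X, (ENNReal.ofReal (1 - ρ p.1 p.2)).toReal • |k p.1 - k p.2| =
        (1 - ρ p.1 p.2) * |k p.1 - k p.2| := by
      intro p
      rw [ENNReal.toReal_ofReal (by linarith [hρ.le_one p.1 p.2]), smul_eq_mul]
    simp only [this]
    rw [integral_prod]
    refine Integrable.of_bound hm2.aestronglyMeasurable 1 (ae_of_all _ fun p => ?_)
    rw [Real.norm_eq_abs, abs_mul, abs_abs, abs_of_nonneg (by linarith [hρ.le_one p.1 p.2])]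
    have : |k p.1 - k p.2| ≤ 1 := by
      rw [abs_le]; constructor <;> linarith [hk0 p.1, hk0 p.2, hk1 p.1, hk1 p.2]
    exact mul_le_one₀ (by linarith [hρ.nonneg p.1 p.2]) (abs_nonneg _) this
  rw [hconv]
  have hreal : (nuM μ ρ).real Set.univ = dens μ ρ := by
    rw [measureReal_def, hρ.nu_univ hT, ENNReal.toReal_ofReal hd.le]
  calc ∫ p, |k p.1 - k p.2| ∂(nuM μ ρ)
      ≤ ∫ p, (1 / ((N : ℝ) + 1) + D.indicator (fun _ => 1) p) ∂(nuM μ ρ) := by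
        apply integral_mono_of_nonneg (ae_of_all _ fun p => abs_nonneg _) _ (ae_of_all _ hpt)
        exact (integrable_const _).add ((integrable_const _).indicator hDm)
    _ = 1 / ((N : ℝ) + 1) * dens μ ρ + (nuM μ ρ).real D := by
        rw [integral_add (integrable_const _) ((integrable_const _).indicator hDm),
          integral_const, hreal, smul_eq_mul, integral_indicator_const _ hDm]
        simp [mul_comm]
    _ ≤ η / 2 * dens μ ρ + η / 2 * dens μ ρ := by gcongr
    _ = η * dens μ ρ := by ring

end sig


section rhoJ
variable {X : Type*} [MetricSpace X] [CompactSpace X] [MeasurableSpace X] [BorelSpace X]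
  {T : X → X} {μ : Measure X}

/-- L1 distance of fibres -/
noncomputable def psiK (μ : Measure X) (K : X × X → ℝ) (x x' : X) : ENNReal :=
  ∫⁻ y, ‖K (x, y) - K (x', y)‖ₑ ∂μ

/-- total boundedness in measure -/
def PreTB (μ : Measure X) (ψ : X → X → ENNReal) : Prop :=
  ∀ ε : ℝ, 0 < ε → ∃ κ : ℝ, 0 < κ ∧ ∃ G : Set X, MeasurableSet G ∧ μ.real Gᶜ ≤ ε ∧
    ∀ x ∈ G, ∀ x' ∈ G, dist x x' < κ → ψ x x' ≤ ENNReal.ofReal ε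

lemma preTB_add [IsProbabilityMeasure μ] {ψ φ : X → X → ENNReal} (h1 : PreTB μ ψ)
    (h2 : PreTB μ φ) :
    PreTB μ (fun x x' => ψ x x' + φ x x') := by
  intro ε hε
  obtain ⟨κ, hκ, G, hG, hGμ, h⟩ := h1 (ε / 2) (half_pos hε)
  obtain ⟨κ', hκ', G', hG', hGμ', h'⟩ := h2 (ε / 2) (half_pos hε)
  refine ⟨min κ κ', lt_min hκ hκ', G ∩ G', hG.inter hG', ?_, ?_⟩
  · rw [Set.compl_inter]
    exact (measureReal_union_le _ _).trans (by linarith)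
  · intro x hx x' hx' hd
    have e : ENNReal.ofReal ε = ENNReal.ofReal (ε / 2) + ENNReal.ofReal (ε / 2) := by
      rw [← ENNReal.ofReal_add (by linarith) (by linarith)]; congr 1; ring
    rw [e]
    exact add_le_add (h x hx.1 x' hx'.1 (hd.trans_le (min_le_left _ _)))
      (h' x hx.2 x' hx'.2 (hd.trans_le (min_le_right _ _)))

lemma preTB_psiK [IsProbabilityMeasure μ] (K : X × X → ℝ) (hKm : Measurable K)
    (hK : Integrable K (μ.prod μ)) : PreTB μ (psiK μ K) := by
  intro ε hε
  have hδ : 0 < ENNReal.ofReal (ε / 3 * ε) := by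
    rw [ENNReal.ofReal_pos]; positivity
  obtain ⟨Θ, hΘ, -⟩ := hK.exists_boundedContinuous_lintegral_sub_le hδ.ne'
  set e : X → ENNReal := fun x => ∫⁻ y, ‖K (x, y) - Θ (x, y)‖ₑ ∂μ with he
  have hΘm : Measurable Θ := Θ.continuous.measurable
  have hem : Measurable e := by
    have : Measurable (fun p : X × X => ‖K p - Θ p‖ₑ) := (hKm.sub hΘm).enorm
    exact this.lintegral_prod_right'
  have hei : ∫⁻ x, e x ∂μ ≤ ENNReal.ofReal (ε / 3 * ε) := by
    have hmm : Measurable (fun p : X × X => ‖K p - Θ p‖ₑ) := (hKm.sub hΘm).enorm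
    rw [lintegral_prod _ hmm.aemeasurable] at hΘ
    exact hΘ
  have huc : UniformContinuous Θ := CompactSpace.uniformContinuous_of_continuous Θ.continuous
  obtain ⟨κ, hκ, hκ2⟩ := Metric.uniformContinuous_iff.1 huc (ε / 3) (by positivity)
  have h3 : ENNReal.ofReal (ε / 3) ≠ 0 := by
    rw [ne_eq, ENNReal.ofReal_eq_zero, not_le]; positivity
  refine ⟨κ, hκ, {x | e x ≤ ENNReal.ofReal (ε / 3)}, measurableSet_le hem measurable_const, ?_, ?_⟩
  · have h1 := meas_ge_le_lintegral_div hem.aemeasurable h3 ENNReal.ofReal_ne_top (μ := μ)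
    have h2 : μ {x | e x ≤ ENNReal.ofReal (ε / 3)}ᶜ ≤ ENNReal.ofReal ε := by
      calc μ {x | e x ≤ ENNReal.ofReal (ε / 3)}ᶜ ≤ μ {x | ENNReal.ofReal (ε / 3) ≤ e x} := by
            apply measure_mono
            intro x hx
            have hx : ¬ (e x ≤ ENNReal.ofReal (ε / 3)) := hx
            exact (not_le.1 hx).le
        _ ≤ _ := h1
        _ ≤ ENNReal.ofReal (ε / 3 * ε) / ENNReal.ofReal (ε / 3) := by gcongr
        _ = ENNReal.ofReal ε := by
            rw [← ENNReal.ofReal_div_of_pos (by positivity)]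
            congr 1
            field_simp
    exact ENNReal.toReal_le_of_le_ofReal hε.le h2
  · intro x hx x' hx' hd
    have hpt : ∀ y, ‖K (x, y) - K (x', y)‖ₑ ≤ ‖K (x, y) - Θ (x, y)‖ₑ +
        (ENNReal.ofReal (ε / 3) + ‖K (x', y) - Θ (x', y)‖ₑ) := by
      intro y
      have h1 : K (x, y) - K (x', y) = (K (x, y) - Θ (x, y)) +
          ((Θ (x, y) - Θ (x', y)) - (K (x', y) - Θ (x', y))) := by ring
      rw [h1]
      refine (enorm_add_le _ _).trans ?_
      gcongr
      refine enorm_sub_le.trans ?_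
      gcongr
      rw [← ofReal_norm]
      apply ENNReal.ofReal_le_ofReal
      have := hκ2 (a := (x, y)) (b := (x', y)) (by rw [Prod.dist_eq]; simpa using hd)
      rw [← dist_eq_norm]
      exact this.le
    calc psiK μ K x x' ≤ ∫⁻ y, (‖K (x, y) - Θ (x, y)‖ₑ +
        (ENNReal.ofReal (ε / 3) + ‖K (x', y) - Θ (x', y)‖ₑ)) ∂μ := lintegral_mono hpt
      _ = e x + (ENNReal.ofReal (ε / 3) + e x') := by
        rw [lintegral_add_left, lintegral_add_left measurable_const]
        · simp [he]
        · exact ((hKm.sub hΘm).comp measurable_prodMk_left).enorm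
      _ ≤ ENNReal.ofReal (ε / 3) + (ENNReal.ofReal (ε / 3) + ENNReal.ofReal (ε / 3)) := by
        gcongr
        · exact hx
        · exact hx'
      _ = ENNReal.ofReal ε := by
        rw [← ENNReal.ofReal_add (by positivity) (by positivity),
          ← ENNReal.ofReal_add (by positivity) (by positivity)]
        congr 1; ring

/-- sum of fibre distances along the orbit -/
noncomputable def phiJ (T : X → X) (μ : Measure X) (ℓ : ℕ) (J : X × X → ℝ) (x x' : X) : ENNReal :=
  ∑ r ∈ Finset.range ℓ, psiK μ J (T^[r] x) (T^[r] x')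

lemma preTB_phiJ [IsProbabilityMeasure μ] (hT : MeasurePreserving T μ μ) (ℓ : ℕ) (J : X × X → ℝ)
    (hJm : Measurable J) (hJ : Integrable J (μ.prod μ)) : PreTB μ (phiJ T μ ℓ J) := by
  induction ℓ with
  | zero =>
    intro ε hε
    exact ⟨1, one_pos, Set.univ, MeasurableSet.univ, by simpa using hε.le, by simp [phiJ]⟩
  | succ n ih =>
    have hmp : MeasurePreserving (Prod.map T^[n] (id : X → X)) (μ.prod μ) (μ.prod μ) :=
      (hT.iterate n).prod (MeasurePreserving.id μ)
    have h1 := preTB_psiK (μ := μ) (fun p => J (Prod.map T^[n] id p)) (hJm.comp hmp.measurable)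
      (hmp.integrable_comp_of_integrable hJ)
    have h2 := preTB_add ih h1
    have : phiJ T μ (n + 1) J = fun x x' => phiJ T μ n J x x' +
        psiK μ (fun p => J (Prod.map T^[n] id p)) x x' := by
      funext x x'
      rw [phiJ, Finset.sum_range_succ]
      rfl
    rw [this]
    exact h2

/-- the pseudometric attached to an invariant function -/
noncomputable def rhoJ (T : X → X) (μ : Measure X) (ℓ : ℕ) (J : X × X → ℝ) (x x' : X) : ℝ :=
  (min 1 (phiJ T μ ℓ J x x')).toReal

lemma rhoJ_good [IsProbabilityMeasure μ] (hT : MeasurePreserving T μ μ) (ℓ m : ℕ) (hℓ : 0 < ℓ)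
    (J : X × X → ℝ) (hJm : Measurable J) (hJ : Integrable J (μ.prod μ))
    (hJT : ∀ x y, J (T^[ℓ] x, T^[m] y) = J (x, y)) : GoodPM T μ (rhoJ T μ ℓ J) where
  meas := by
    have hpsi : Measurable (fun p : X × X => psiK μ J p.1 p.2) := by
      have : Measurable (fun q : (X × X) × X => ‖J (q.1.1, q.2) - J (q.1.2, q.2)‖ₑ) := by fun_prop
      exact this.lintegral_prod_right'
    have : Measurable (fun p : X × X => phiJ T μ ℓ J p.1 p.2) := by
      refine Finset.measurable_fun_sum _ fun r _ => ?_
      have hr : Measurable (fun p : X × X => (T^[r] p.1, T^[r] p.2)) :=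
        (((hT.measurable.iterate r).comp measurable_fst).prodMk
          ((hT.measurable.iterate r).comp measurable_snd))
      exact hpsi.comp hr
    exact (measurable_const.min this).ennreal_toReal
  nonneg := fun x y => ENNReal.toReal_nonneg
  le_one := fun x y => ENNReal.toReal_le_of_le_ofReal zero_le_one (by simp)
  symm := fun x y => by
    simp only [rhoJ, phiJ, psiK]
    simp only [enorm_sub_rev]
  tri := fun x y z => by
    have hfin : ∀ a : ENNReal, min 1 a ≠ ⊤ := fun a =>
      ((min_le_left _ _).trans_lt ENNReal.one_lt_top).ne
    rw [rhoJ, rhoJ, rhoJ, ← ENNReal.toReal_add (hfin _) (hfin _)]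
    apply ENNReal.toReal_mono (ENNReal.add_ne_top.2 ⟨hfin _, hfin _⟩)
    have h1 : phiJ T μ ℓ J x z ≤ phiJ T μ ℓ J x y + phiJ T μ ℓ J y z := by
      rw [phiJ, phiJ, phiJ, ← Finset.sum_add_distrib]
      apply Finset.sum_le_sum
      intro r _
      rw [psiK, psiK, psiK, ← lintegral_add_left]
      · apply lintegral_mono
        intro w
        have : J (T^[r] x, w) - J (T^[r] z, w) = (J (T^[r] x, w) - J (T^[r] y, w)) +
          (J (T^[r] y, w) - J (T^[r] z, w)) := by ring
        simp only [this]
        exact enorm_add_le _ _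
      · fun_prop
    rcases le_total 1 (phiJ T μ ℓ J x y) with h | h
    · rw [min_eq_left h]
      exact (min_le_left _ _).trans le_self_add
    · rcases le_total 1 (phiJ T μ ℓ J y z) with h' | h'
      · rw [min_eq_left h']
        exact (min_le_left _ _).trans le_add_self
      · rw [min_eq_right h, min_eq_right h']
        exact (min_le_right _ _).trans h1
  inv := fun x x' => by
    obtain ⟨k, rfl⟩ : ∃ k, ℓ = k + 1 := ⟨ℓ - 1, by omega⟩
    have h1 : psiK μ J (T^[k + 1] x) (T^[k + 1] x') = psiK μ J x x' := by
      have hmm : Measurable (fun y => ‖J (T^[k + 1] x, y) - J (T^[k + 1] x', y)‖ₑ) := by fun_prop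
      rw [psiK, ← (hT.iterate m).lintegral_comp hmm]
      simp only [hJT]
      rfl
    have h2 : phiJ T μ (k + 1) J (T x) (T x') = phiJ T μ (k + 1) J x x' := by
      rw [phiJ, phiJ, Finset.sum_range_succ]
      simp only [← Function.iterate_succ_apply]
      rw [Finset.sum_range_succ', h1]
      rfl
    rw [rhoJ, rhoJ, h2]
  tb := fun ε hε => by
    obtain ⟨κ, hκ, G, hG, hGμ, h⟩ := preTB_phiJ hT ℓ J hJm hJ ε hε
    have : Nonempty X := nonempty_of_isProbabilityMeasure μ
    obtain ⟨r, c, hc, hcr, hcd⟩ := exists_cells (X := X) κ hκ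
    refine ⟨r, c, G, hc, hG, hcr, hGμ, fun x hx x' hx' hxx => ?_⟩
    exact ENNReal.toReal_le_of_le_ofReal hε.le
      ((min_le_right _ _).trans (h x hx x' hx' (hcd x x' hxx)))

lemma gJ_meas [IsProbabilityMeasure μ] (hT : Ergodic T μ) (ℓ m : ℕ) (hℓ : 0 < ℓ)
    (J : X × X → ℝ) (hJm : Measurable J) (hJ : Integrable J (μ.prod μ))
    (hJT : ∀ x y, J (T^[ℓ] x, T^[m] y) = J (x, y)) (f : X → ℝ) (hf : Measurable f)
    (hf1 : ∀ y, |f y| ≤ 1) :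
    Measurable[Bsig hT] (fun x => ∫ y, f y * J (x, y) ∂μ) := by
  have hm : Measurable (fun p : X × X => f p.2 * J p) := (hf.comp measurable_snd).mul hJm
  have hX1m : MeasurableSet {x | Integrable (fun y => J (x, y)) μ} :=
    measurableSet_integrable hJm.stronglyMeasurable
  refine lip_meas hT _ hm.stronglyMeasurable.integral_prod_right.measurable _
    (rhoJ_good hT.toMeasurePreserving ℓ m hℓ J hJm hJ hJT) _ hX1m
    (hJ.prod_right_ae) ?_
  intro x hx x' hx' hlt
  have hphi : phiJ T μ ℓ J x x' < 1 := by
    by_contra h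
    rw [rhoJ, min_eq_left (not_lt.1 h)] at hlt
    simp at hlt
  have hρ : rhoJ T μ ℓ J x x' = (phiJ T μ ℓ J x x').toReal := by
    rw [rhoJ, min_eq_right hphi.le]
  have h1 : psiK μ J x x' ≤ phiJ T μ ℓ J x x' := by
    have := Finset.single_le_sum (f := fun r => psiK μ J (T^[r] x) (T^[r] x'))
      (fun _ _ => zero_le) (Finset.mem_range.2 hℓ)
    exact this
  have hx : Integrable (fun y => J (x, y)) μ := hx
  have hx' : Integrable (fun y => J (x', y)) μ := hx'
  have hi : ∀ z, Integrable (fun y => J (z, y)) μ → Integrable (fun y => f y * J (z, y)) μ :=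
    fun z hz => hz.bdd_mul (c := 1) hf.aestronglyMeasurable (ae_of_all _ hf1)
  rw [hρ, ← integral_sub (hi x hx) (hi x' hx')]
  calc |∫ y, (f y * J (x, y) - f y * J (x', y)) ∂μ|
      ≤ ∫ y, |f y * J (x, y) - f y * J (x', y)| ∂μ := abs_integral_le_integral_abs
    _ ≤ ∫ y, ‖J (x, y) - J (x', y)‖ ∂μ := by
        apply integral_mono ((hi x hx).sub (hi x' hx')).abs (hx.sub hx').norm
        intro y
        simp only [Real.norm_eq_abs, Pi.sub_apply]
        rw [← mul_sub, abs_mul]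
        exact mul_le_of_le_one_left (abs_nonneg _) (hf1 y)
    _ = (psiK μ J x x').toReal := by
        exact integral_norm_eq_lintegral_enorm (hx.sub hx').aestronglyMeasurable
    _ ≤ _ := ENNReal.toReal_mono (hphi.trans ENNReal.one_lt_top).ne h1

lemma theta_meas [IsProbabilityMeasure μ] (hT : Ergodic T μ) (ρ : X → X → ℝ)
    (hρ : GoodPM T μ ρ) (p : X) : Measurable[Bsig hT] (fun x => 1 - ρ x p) := by
  refine lip_meas hT _ ((hρ.meas_left p).const_sub 1) ρ hρ Set.univ MeasurableSet.univ (by simp) ?_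
  intro x _ x' _ _
  have := hρ.abs_sub_le x' x p
  rw [hρ.symm x' x] at this
  convert this using 2
  ring

end rhoJ


section decor
variable {X : Type*} [MetricSpace X] [CompactSpace X] [MeasurableSpace X] [BorelSpace X]
  {T : X → X} {μ : Measure X}

lemma decor_zero [IsProbabilityMeasure μ] (hT : Ergodic T μ) (ℓ m : ℕ) (hℓ : 0 < ℓ)
    (w θ f : X → ℝ) (hw : Measurable w) (hw1 : ∀ x, |w x| ≤ 1)
    (hw0 : μ[w | Bsig hT] =ᵐ[μ] 0)
    (hθ : Measurable[Bsig hT] θ) (hθ1 : ∀ x, |θ x| ≤ 1)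
    (hf : Measurable f) (hf1 : ∀ x, |f x| ≤ 1)
    (J : X × X → ℝ) (hJm : Measurable J) (hJ : Integrable J (μ.prod μ))
    (hJT : ∀ x y, J (T^[ℓ] x, T^[m] y) = J (x, y)) :
    ∫ p : X × X, (θ p.1 * w p.1 * f p.2) * J p ∂(μ.prod μ) = 0 := by
  have hθm : Measurable θ := hθ.mono (Bsig_le hT) le_rfl
  have hb : ∀ p : X × X, ‖θ p.1 * w p.1 * f p.2‖ ≤ 1 := by
    intro p
    rw [Real.norm_eq_abs, abs_mul, abs_mul]
    exact mul_le_one₀ (mul_le_one₀ (hθ1 _) (abs_nonneg _) (hw1 _)) (abs_nonneg _) (hf1 _)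
  have hm : Measurable (fun p : X × X => θ p.1 * w p.1 * f p.2) := by fun_prop
  have hi : Integrable (fun p : X × X => (θ p.1 * w p.1 * f p.2) * J p) (μ.prod μ) :=
    hJ.bdd_mul (c := 1) hm.aestronglyMeasurable (ae_of_all _ hb)
  rw [integral_prod _ hi]
  set g : X → ℝ := fun x => ∫ y, f y * J (x, y) ∂μ with hg
  have hgm : Measurable[Bsig hT] g := gJ_meas hT ℓ m hℓ J hJm hJ hJT f hf hf1
  have h1 : ∀ x, ∫ y, (θ x * w x * f y) * J (x, y) ∂μ = (θ x * g x) * w x := by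
    intro x
    rw [hg]
    simp only [mul_assoc]
    rw [integral_const_mul, integral_const_mul]
    ring
  have hIntg : Integrable (fun x => (θ x * g x) * w x) μ := by
    have := hi.integral_prod_left
    simpa only [h1] using this
  simp only [h1]
  have hsm : StronglyMeasurable[Bsig hT] (fun x => θ x * g x) :=
    (Measurable.mul (m := Bsig hT) (M := ℝ) hθ hgm).stronglyMeasurable
  have hwi : Integrable w μ := Integrable.of_bound hw.aestronglyMeasurable 1 (ae_of_all _ hw1)
  have h2 := condExp_mul_of_stronglyMeasurable_left (μ := μ) hsm (g := w) hIntg hwi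
  rw [← integral_condExp (Bsig_le hT)]
  have h3 : μ[(fun x => θ x * g x) * w | Bsig hT] =ᵐ[μ] 0 := by
    filter_upwards [h2, hw0] with x hx1 hx2
    rw [hx1, Pi.mul_apply, hx2]
    simp
  have h4 := integral_congr_ae h3
  simp only [Pi.zero_apply, integral_zero] at h4
  exact h4

lemma decor [IsProbabilityMeasure μ] (hT : Ergodic T μ) (ℓ m : ℕ) (hℓ : 0 < ℓ)
    (w θ f : X → ℝ) (hw : Measurable w) (hw1 : ∀ x, |w x| ≤ 1)
    (hw0 : μ[w | Bsig hT] =ᵐ[μ] 0)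
    (hθ : Measurable[Bsig hT] θ) (hθ1 : ∀ x, |θ x| ≤ 1)
    (hf : Measurable f) (hf1 : ∀ x, |f x| ≤ 1) :
    Tendsto (fun M : ℕ => ∫ x, ∫ y, |(∑ n ∈ Finset.range M,
      θ (T^[ℓ * n] x) * w (T^[ℓ * n] x) * f (T^[m * n] y)) / M| ∂μ ∂μ) atTop (𝓝 0) := by
  have hθm : Measurable θ := hθ.mono (Bsig_le hT) le_rfl
  have hb : ∀ p : X × X, |θ p.1 * w p.1 * f p.2| ≤ 1 := by
    intro p
    rw [abs_mul, abs_mul]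
    exact mul_le_one₀ (mul_le_one₀ (hθ1 _) (abs_nonneg _) (hw1 _)) (abs_nonneg _) (hf1 _)
  have hm : Measurable (fun p : X × X => θ p.1 * w p.1 * f p.2) := by fun_prop
  have hτ : MeasurePreserving (Prod.map T^[ℓ] T^[m]) (μ.prod μ) (μ.prod μ) :=
    (hT.toMeasurePreserving.iterate ℓ).prod (hT.toMeasurePreserving.iterate m)
  have key := mean_erg (ν := μ.prod μ) (Prod.map T^[ℓ] T^[m]) hτ
    (fun p => θ p.1 * w p.1 * f p.2) hm 1 hb (by
      intro J hJm hJL hJT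
      exact decor_zero hT ℓ m hℓ w θ f hw hw1 hw0 hθ hθ1 hf hf1 J hJm
        (hJL.integrable (by norm_num)) (fun x y => hJT (x, y)))
  refine key.congr fun M => ?_
  have hit : ∀ n : ℕ, ∀ p : X × X, (Prod.map T^[ℓ] T^[m])^[n] p = (T^[ℓ * n] p.1, T^[m * n] p.2) := by
    intro n p
    rw [Prod.map_iterate, Function.iterate_mul, Function.iterate_mul]
    rfl
  simp only [hit]
  rw [integral_prod]
  have hmM : Measurable (fun p : X × X => |(∑ n ∈ Finset.range M,
      θ (T^[ℓ * n] p.1) * w (T^[ℓ * n] p.1) * f (T^[m * n] p.2)) / M|) := by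
    have hTm := fun n => hT.measurable.iterate n
    have : Measurable (fun p : X × X => ∑ n ∈ Finset.range M,
      θ (T^[ℓ * n] p.1) * w (T^[ℓ * n] p.1) * f (T^[m * n] p.2)) := by
      refine Finset.measurable_fun_sum _ fun n _ => ?_
      have h1 := hTm (ℓ * n)
      have h2 := hTm (m * n)
      fun_prop
    exact (this.div_const _).abs
  refine Integrable.of_bound hmM.aestronglyMeasurable 1 (ae_of_all _ fun p => ?_)
  rw [Real.norm_eq_abs, abs_abs, abs_div, Nat.abs_cast]
  refine div_le_one_of_le₀ ?_ (Nat.cast_nonneg _)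
  refine (Finset.abs_sum_le_sum_abs _ _).trans ?_
  calc _ ≤ ∑ n ∈ Finset.range M, (1 : ℝ) := Finset.sum_le_sum fun n _ =>
        hb (T^[ℓ * n] p.1, T^[m * n] p.2)
    _ = M := by simp

end decor


lemma exists_prog {X : Type*} [MetricSpace X] [CompactSpace X] {T : X → X} (hTc : Continuous T)
    (a y : X) (ℓ m R : ℕ) (E : ℕ → Set X) (F' : Set X) (hF' : IsClosed F')
    (h : ∀ k : ℕ, ∃ N ≥ k, dist (T^[ℓ * N] a) y < 1 / ((k : ℝ) + 1) ∧
      ∃ j < R, y ∈ E j ∧ T^[m * N + j] y ∈ F') :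
    ∃ j < R, ∃ x₂, ErdosProg T ℓ m a y x₂ ∧ y ∈ E j ∧ T^[j] x₂ ∈ F' := by
  choose N hN hd j hj hE hF using h
  obtain ⟨j₀, hj₀R, hfr⟩ : ∃ j₀ < R, ∃ᶠ k in atTop, j k = j₀ := by
    by_contra hcon
    push Not at hcon
    have hall : ∀ᶠ k in atTop, ∀ i ∈ Finset.range R, j k ≠ i := by
      rw [Filter.eventually_all_finset]
      intro i hi
      exact hcon i (Finset.mem_range.1 hi)
    obtain ⟨k, hk⟩ := hall.exists
    exact hk (j k) (Finset.mem_range.2 (hj k)) rfl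
  obtain ⟨φ, hφ, hφj⟩ := extraction_of_frequently_atTop hfr
  have hcl : IsClosed (T^[j₀] ⁻¹' F') := hF'.preimage (hTc.iterate j₀)
  have hmem : ∀ n, T^[m * N (φ n)] y ∈ T^[j₀] ⁻¹' F' := by
    intro n
    rw [Set.mem_preimage, ← Function.iterate_add_apply, Nat.add_comm]
    have := hF (φ n)
    rwa [hφj n] at this
  obtain ⟨x₂, hx₂, ψ, hψ, hlim⟩ := hcl.isCompact.tendsto_subseq hmem
  have htop : Tendsto (fun n => N (φ (ψ n))) atTop atTop :=
    tendsto_atTop_mono (fun n => (hψ.id_le n).trans ((hφ.id_le _).trans (hN _))) tendsto_id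
  obtain ⟨χ, hχ, hmono⟩ := strictMono_subseq_of_tendsto_atTop htop
  refine ⟨j₀, hj₀R, x₂, ⟨fun i => N (φ (ψ (χ (i + 1)))), ?_, ?_, ?_⟩, ?_, hx₂⟩
  · intro i i' hii
    exact hmono (Nat.succ_lt_succ hii)
  · intro i
    exact (Nat.zero_le _).trans_lt (hmono (Nat.succ_pos i))
  · have hsh : Tendsto (fun i => χ (i + 1)) atTop atTop :=
      hχ.tendsto_atTop.comp (tendsto_add_atTop_nat 1)
    refine Tendsto.prodMk_nhds ?_ (hlim.comp hsh)
    rw [tendsto_iff_dist_tendsto_zero]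
    refine squeeze_zero (fun _ => dist_nonneg) (fun i => (hd _).le) ?_
    have hsh2 : Tendsto (fun i => φ (ψ (χ (i + 1)))) atTop atTop :=
      hφ.tendsto_atTop.comp (hψ.tendsto_atTop.comp hsh)
    exact (tendsto_one_div_add_atTop_nhds_zero_nat (𝕜 := ℝ)).comp hsh2
  · have := hE (φ 0)
    rwa [hφj 0] at this

lemma sum_blocks (g : ℕ → ℝ) (p n : ℕ) :
    ∑ t ∈ Finset.range (p * n), g t = ∑ k ∈ Finset.range n, ∑ i ∈ Finset.range p, g (p * k + i) := by
  induction n with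
  | zero => simp
  | succ n ih => rw [Nat.mul_succ, Finset.sum_range_add, ih, Finset.sum_range_succ]

lemma E_shift {X : Type*} {T : X → X} (E : ℕ → Set X) (p R : ℕ)
    (hE : ∀ i, i + p < R → E (i + p) = T ⁻¹' E i) :
    ∀ k i, p * k + i < R → E (p * k + i) = T^[k] ⁻¹' E i := by
  intro k
  induction k with
  | zero => intro i _; simp
  | succ k ih =>
    intro i hi
    have h1 : p * (k + 1) + i = (p * k + i) + p := by ring
    rw [h1, hE _ (by omega), ih i (by rw [h1] at hi; omega), ← Set.preimage_comp,
      Function.iterate_succ]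

lemma comb_E {X : Type*} {T : X → X} (E : ℕ → Set X) (p R ℓ : ℕ) (hR : R ≤ p * ℓ)
    (hE : ∀ i, i + p < R → E (i + p) = T ⁻¹' E i) (hp : 0 < p) (y : X) :
    ∑ k ∈ Finset.range ℓ, ∑ i ∈ Finset.range p, (E i).indicator (fun _ => (1 : ℝ)) (T^[k] y) ≤
      ∑ j ∈ Finset.range R, (E j).indicator (fun _ => (1 : ℝ)) y + ((p : ℝ) * ℓ - R) := by
  set g : ℕ → ℝ := fun t => (E (t % p)).indicator (fun _ => (1 : ℝ)) (T^[t / p] y) with hg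
  have hg1 : ∀ t, g t ≤ 1 := fun t => Set.indicator_le_self' (fun _ _ => zero_le_one) _
  have h1 : ∑ k ∈ Finset.range ℓ, ∑ i ∈ Finset.range p,
      (E i).indicator (fun _ => (1 : ℝ)) (T^[k] y) = ∑ t ∈ Finset.range (p * ℓ), g t := by
    rw [sum_blocks]
    refine Finset.sum_congr rfl fun k _ => Finset.sum_congr rfl fun i hi => ?_
    have hi := Finset.mem_range.1 hi
    simp only [hg]
    rw [Nat.mul_add_mod, Nat.mod_eq_of_lt hi, Nat.mul_add_div hp, Nat.div_eq_of_lt hi, Nat.add_zero]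
  rw [h1]
  obtain ⟨s, hs⟩ := Nat.exists_eq_add_of_le hR
  rw [hs, Finset.sum_range_add]
  have h2 : ∑ j ∈ Finset.range R, g j = ∑ j ∈ Finset.range R, (E j).indicator (fun _ => (1 : ℝ)) y := by
    refine Finset.sum_congr rfl fun j hj => ?_
    have hj := Finset.mem_range.1 hj
    have h3 := E_shift E p R hE (j / p) (j % p) (by rw [Nat.div_add_mod]; exact hj)
    rw [Nat.div_add_mod] at h3
    rw [h3]
    rfl
  rw [h2]
  have h4 : ∑ x ∈ Finset.range s, g (R + x) ≤ s := by
    calc _ ≤ ∑ x ∈ Finset.range s, (1 : ℝ) := Finset.sum_le_sum fun x _ => hg1 _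
      _ = s := by simp
  have h5 : (p : ℝ) * ℓ = R + s := by exact_mod_cast hs
  linarith

lemma ind_bounds {X : Type*} (A : Set X) (x : X) :
    0 ≤ A.indicator (fun _ => (1 : ℝ)) x ∧ A.indicator (fun _ => (1 : ℝ)) x ≤ 1 :=
  ⟨Set.indicator_nonneg (fun _ _ => zero_le_one) _, Set.indicator_le_self' (fun _ _ => zero_le_one) _⟩

/-- the counting function -/
noncomputable def Hfun {X : Type*} (T : X → X) (m R : ℕ) (A : ℕ → Set X) (F' : Set X)
    (N : ℕ) (y : X) : ℝ :=
  ∑ j ∈ Finset.range R, (A j).indicator (fun _ => (1 : ℝ)) y *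
    F'.indicator (fun _ => (1 : ℝ)) (T^[j] (T^[m * N] y))

lemma H_sum_lower {X : Type*} (T : X → X) (ℓ m p : ℕ) (hp : 0 < p) (hR : ℓ + m ≤ p * ℓ)
    (E : ℕ → Set X) (hE : ∀ i, i + p < ℓ + m → E (i + p) = T ⁻¹' E i)
    (F' Y : Set X) (hℓ : 0 < ℓ) (M c' : ℕ) (x' : X) :
    ∑ t ∈ Finset.range (ℓ * M), (∑ i ∈ Finset.range p, (E i).indicator (fun _ => (1 : ℝ)) (T^[t] x'))
      + ∑ t ∈ Finset.range ((ℓ + m) * M), F'.indicator (fun _ => (1 : ℝ)) (T^[t] (T^[m * c'] x'))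
      - M * (p * ℓ)
      - (ℓ + m) * ∑ t ∈ Finset.range (ℓ * M), Yᶜ.indicator (fun _ => (1 : ℝ)) (T^[t] x')
    ≤ ∑ n ∈ Finset.range M, Hfun T m (ℓ + m) (fun j => E j ∩ Y) F' (c' + n) (T^[ℓ * n] x') := by
  have hpt : ∀ n, (∑ k ∈ Finset.range ℓ, ∑ i ∈ Finset.range p,
        (E i).indicator (fun _ => (1 : ℝ)) (T^[ℓ * n + k] x'))
      + (∑ j ∈ Finset.range (ℓ + m), F'.indicator (fun _ => (1 : ℝ)) (T^[(ℓ + m) * n + j] (T^[m * c'] x')))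
      - p * ℓ - (ℓ + m) * ∑ k ∈ Finset.range ℓ, Yᶜ.indicator (fun _ => (1 : ℝ)) (T^[ℓ * n + k] x')
      ≤ Hfun T m (ℓ + m) (fun j => E j ∩ Y) F' (c' + n) (T^[ℓ * n] x') := by
    intro n
    set y := T^[ℓ * n] x' with hy
    have h1 := comb_E E p (ℓ + m) ℓ hR hE hp y
    have h2 : ∀ k, T^[ℓ * n + k] x' = T^[k] y := by
      intro k; rw [hy, ← Function.iterate_add_apply, Nat.add_comm]
    have h3 : ∀ j, T^[(ℓ + m) * n + j] (T^[m * c'] x') = T^[j] (T^[m * (c' + n)] y) := by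
      intro j
      rw [hy, ← Function.iterate_add_apply, ← Function.iterate_add_apply, ← Function.iterate_add_apply]
      congr 1
      ring
    simp only [h2, h3]
    have h4 : Yᶜ.indicator (fun _ => (1 : ℝ)) y ≤
        ∑ k ∈ Finset.range ℓ, Yᶜ.indicator (fun _ => (1 : ℝ)) (T^[k] y) :=
      Finset.single_le_sum (f := fun k => Yᶜ.indicator (fun _ => (1 : ℝ)) (T^[k] y))
        (fun k _ => (ind_bounds _ _).1) (Finset.mem_range.2 hℓ)
    have h5 : ∀ j, (E j).indicator (fun _ => (1 : ℝ)) y +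
        F'.indicator (fun _ => (1 : ℝ)) (T^[j] (T^[m * (c' + n)] y)) - 1 -
        Yᶜ.indicator (fun _ => (1 : ℝ)) y ≤ (E j ∩ Y).indicator (fun _ => (1 : ℝ)) y *
        F'.indicator (fun _ => (1 : ℝ)) (T^[j] (T^[m * (c' + n)] y)) := by
      intro j
      have hb := ind_bounds F' (T^[j] (T^[m * (c' + n)] y))
      by_cases hyE : y ∈ E j <;> by_cases hyY : y ∈ Y <;>
        simp only [Set.indicator, Set.mem_inter_iff, Set.mem_compl_iff, hyE, hyY] at hb ⊢ <;>
        simp at hb ⊢ <;> linarith [hb.1, hb.2]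
    have h6 := Finset.sum_le_sum fun j (_ : j ∈ Finset.range (ℓ + m)) => h5 j
    rw [Finset.sum_sub_distrib, Finset.sum_sub_distrib, Finset.sum_add_distrib] at h6
    simp only [Finset.sum_const, Finset.card_range, nsmul_eq_mul, mul_one] at h6
    push_cast at h1 h6
    have h7 : ((ℓ : ℝ) + m) * Yᶜ.indicator (fun _ => (1 : ℝ)) y ≤ (ℓ + m) *
        ∑ k ∈ Finset.range ℓ, Yᶜ.indicator (fun _ => (1 : ℝ)) (T^[k] y) := by gcongr
    rw [Hfun]
    linarith
  have := Finset.sum_le_sum fun n (_ : n ∈ Finset.range M) => hpt n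
  refine le_trans (le_of_eq ?_) this
  rw [Finset.sum_sub_distrib, Finset.sum_sub_distrib, Finset.sum_add_distrib,
    sum_blocks, sum_blocks, sum_blocks, Finset.mul_sum]
  simp only [Finset.sum_const, Finset.card_range, nsmul_eq_mul]


/-- deviation of the ergodic average -/
noncomputable def Dv {X : Type*} [MeasurableSpace X] (T : X → X) (μ : Measure X) (h : X → ℝ)
    (N : ℕ) (y : X) : ℝ :=
  |(∑ k ∈ Finset.range N, h (T^[k] y)) / N - ∫ x, h x ∂μ|

section lowerA
variable {X : Type*} [MeasurableSpace X] {T : X → X} {μ : Measure X}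

lemma Dv_meas (hT : Measurable T) (h : X → ℝ) (hm : Measurable h) (N : ℕ) :
    Measurable (Dv T μ h N) := by
  have h1 : Measurable (fun y => ∑ k ∈ Finset.range N, h (T^[k] y)) :=
    Finset.measurable_fun_sum _ fun k _ => hm.comp (hT.iterate k)
  exact ((h1.div_const _).sub_const _).abs

lemma Dv_int [IsProbabilityMeasure μ] (hT : Measurable T) (h : X → ℝ) (hm : Measurable h)
    (C : ℝ) (hb : ∀ y, |h y| ≤ C) (N : ℕ) : Integrable (Dv T μ h N) μ := by
  refine Integrable.of_bound (Dv_meas hT h hm N).aestronglyMeasurable (C + |∫ x, h x ∂μ|)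
    (ae_of_all _ fun y => ?_)
  rw [Dv, Real.norm_eq_abs, abs_abs]
  refine (abs_sub _ _).trans ?_
  gcongr
  have hC : 0 ≤ C := (abs_nonneg _).trans (hb y)
  rw [abs_div, Nat.abs_cast]
  rcases Nat.eq_zero_or_pos N with h0 | h0
  · subst h0; simpa using hC
  · have : (0 : ℝ) < N := by exact_mod_cast h0
    rw [div_le_iff₀ this]
    refine (Finset.abs_sum_le_sum_abs _ _).trans ((Finset.sum_le_sum fun k _ => hb _).trans ?_)
    simp [mul_comm]

lemma Hfun_meas (hT : Measurable T) (m R : ℕ) (A : ℕ → Set X) (hA : ∀ j, MeasurableSet (A j))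
    (F' : Set X) (hF : MeasurableSet F') (N : ℕ) : Measurable (Hfun T m R A F' N) := by
  unfold Hfun
  refine Finset.measurable_fun_sum _ fun j _ => ?_
  exact (measurable_const.indicator (hA j)).mul
    ((measurable_const.indicator hF).comp ((hT.iterate j).comp (hT.iterate _)))

lemma Hfun_bounds {X : Type*} (T : X → X) (m R : ℕ) (A : ℕ → Set X)
    (F' : Set X) (N : ℕ) (y : X) : 0 ≤ Hfun T m R A F' N y ∧ Hfun T m R A F' N y ≤ R := by
  unfold Hfun
  constructor
  · exact Finset.sum_nonneg fun j _ => mul_nonneg (ind_bounds _ _).1 (ind_bounds _ _).1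
  · calc _ ≤ ∑ j ∈ Finset.range R, (1 : ℝ) := Finset.sum_le_sum fun j _ =>
          mul_le_one₀ (ind_bounds _ _).2 (ind_bounds _ _).1 (ind_bounds _ _).2
      _ = R := by simp

lemma lowerA [IsProbabilityMeasure μ] (hT : Ergodic T μ) (ℓ m p : ℕ) (hp : 0 < p)
    (hR : ℓ + m ≤ p * ℓ) (hℓ : 0 < ℓ)
    (E : ℕ → Set X) (hE : ∀ i, i + p < ℓ + m → E (i + p) = T ⁻¹' E i)
    (hEm : ∀ i, MeasurableSet (E i))
    (F' Y : Set X) (hF' : MeasurableSet F') (hY : MeasurableSet Y) :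
    ∃ err : ℕ → ℝ, Tendsto err atTop (𝓝 0) ∧ ∀ M > 0, ∀ c', ∀ I : X → ℝ, Measurable I →
      (∀ x, 0 ≤ I x) → (∀ x, I x ≤ 1) →
      (∫ x, I x ∂μ) * (ℓ * ∑ i ∈ Finset.range p, μ.real (E i) + (ℓ + m) * μ.real F' - p * ℓ
        - (ℓ + m) * ℓ * μ.real Yᶜ) - err M ≤
      (∑ n ∈ Finset.range M, ∫ x', I x' *
        Hfun T m (ℓ + m) (fun j => E j ∩ Y) F' (c' + n) (T^[ℓ * n] x') ∂μ) / M := by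
  have hTm : Measurable T := hT.toMeasurePreserving.measurable
  set e : X → ℝ := fun x => ∑ i ∈ Finset.range p, (E i).indicator (fun _ => (1 : ℝ)) x with he
  set f : X → ℝ := F'.indicator (fun _ => (1 : ℝ)) with hf
  set g : X → ℝ := Yᶜ.indicator (fun _ => (1 : ℝ)) with hg
  have hem : Measurable e :=
    Finset.measurable_fun_sum _ fun i _ => measurable_const.indicator (hEm i)
  have hfm : Measurable f := measurable_const.indicator hF'
  have hgm : Measurable g := measurable_const.indicator hY.compl
  have heb : ∀ y, |e y| ≤ p := by
    intro y
    refine (Finset.abs_sum_le_sum_abs _ _).trans ?_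
    calc _ ≤ ∑ i ∈ Finset.range p, (1 : ℝ) := Finset.sum_le_sum fun i _ => by
          rw [abs_of_nonneg (ind_bounds _ _).1]; exact (ind_bounds _ _).2
      _ = p := by simp
  have hfb : ∀ y, |f y| ≤ 1 := fun y => by
    rw [abs_of_nonneg (ind_bounds _ _).1]; exact (ind_bounds _ _).2
  have hgb : ∀ y, |g y| ≤ 1 := fun y => by
    rw [abs_of_nonneg (ind_bounds _ _).1]; exact (ind_bounds _ _).2
  have hei : ∫ x, e x ∂μ = ∑ i ∈ Finset.range p, μ.real (E i) := by
    simp only [he]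
    rw [integral_finsetSum _ fun i _ => (integrable_const _).indicator (hEm i)]
    refine Finset.sum_congr rfl fun i _ => ?_
    rw [integral_indicator_const _ (hEm i)]; simp
  have hfi : ∫ x, f x ∂μ = μ.real F' := by
    simp only [hf]; rw [integral_indicator_const _ hF']; simp
  have hgi : ∫ x, g x ∂μ = μ.real Yᶜ := by
    simp only [hg]; rw [integral_indicator_const _ hY.compl]; simp
  have hRpos : 0 < ℓ + m := by omega
  refine ⟨fun M => ℓ * ∫ x, Dv T μ e (ℓ * M) x ∂μ + (ℓ + m) * ∫ x, Dv T μ f ((ℓ + m) * M) x ∂μ +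
    (ℓ + m) * ℓ * ∫ x, Dv T μ g (ℓ * M) x ∂μ, ?_, ?_⟩
  · have t1 : Tendsto (fun M : ℕ => ℓ * M) atTop atTop := tendsto_id.const_mul_atTop' hℓ
    have t2 : Tendsto (fun M : ℕ => (ℓ + m) * M) atTop atTop := tendsto_id.const_mul_atTop' hRpos
    have a1 := ((mean_erg_ergodic T hT e hem p heb).comp t1).const_mul (ℓ : ℝ)
    have a2 := ((mean_erg_ergodic T hT f hfm 1 hfb).comp t2).const_mul ((ℓ : ℝ) + m)
    have a3 := ((mean_erg_ergodic T hT g hgm 1 hgb).comp t1).const_mul (((ℓ : ℝ) + m) * ℓ)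
    have := (a1.add a2).add a3
    simp only [mul_zero, add_zero] at this
    exact this
  · intro M hM c' I hI hI0 hI1
    have hM' : (0 : ℝ) < M := by exact_mod_cast hM
    have hℓ' : (0 : ℝ) < ℓ := by exact_mod_cast hℓ
    have hR' : (0 : ℝ) < (ℓ : ℝ) + m := by exact_mod_cast hRpos
    set β := ℓ * ∑ i ∈ Finset.range p, μ.real (E i) + (ℓ + m) * μ.real F' - p * ℓ
        - (ℓ + m) * ℓ * μ.real Yᶜ with hβ
    have hHi : ∀ n, Integrable (fun x' => I x' *
        Hfun T m (ℓ + m) (fun j => E j ∩ Y) F' (c' + n) (T^[ℓ * n] x')) μ := by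
      intro n
      refine Integrable.of_bound (C := ((ℓ + m : ℕ) : ℝ)) ?_ (ae_of_all _ fun y => ?_)
      · exact (hI.mul ((Hfun_meas hTm m _ _ (fun j => (hEm j).inter hY) F' hF' _).comp
          (hTm.iterate _))).aestronglyMeasurable
      · have hb := Hfun_bounds T m (ℓ + m) (fun j => E j ∩ Y) F' (c' + n) (T^[ℓ * n] y)
        rw [Real.norm_eq_abs, abs_of_nonneg (mul_nonneg (hI0 y) hb.1)]
        exact (mul_le_of_le_one_left hb.1 (hI1 y)).trans hb.2
    rw [← integral_finsetSum _ fun n _ => hHi n, ← integral_div]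
    have hDe := Dv_int (μ := μ) hTm e hem p heb (ℓ * M)
    have hDg := Dv_int (μ := μ) hTm g hgm 1 hgb (ℓ * M)
    have hmp : MeasurePreserving T^[m * c'] μ μ := hT.toMeasurePreserving.iterate _
    have hDf0 := Dv_int (μ := μ) hTm f hfm 1 hfb ((ℓ + m) * M)
    have hDf : Integrable (fun x => Dv T μ f ((ℓ + m) * M) (T^[m * c'] x)) μ :=
      hmp.integrable_comp_of_integrable hDf0
    have hDfe : ∫ x, Dv T μ f ((ℓ + m) * M) (T^[m * c'] x) ∂μ =
        ∫ x, Dv T μ f ((ℓ + m) * M) x ∂μ := by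
      have hasm : AEStronglyMeasurable (Dv T μ f ((ℓ + m) * M)) (μ.map T^[m * c']) := by
        rw [hmp.map_eq]; exact hDf0.aestronglyMeasurable
      rw [← integral_map hmp.measurable.aemeasurable hasm, hmp.map_eq]
    have hIi : Integrable I μ := Integrable.of_bound (C := 1) hI.aestronglyMeasurable
      (ae_of_all _ fun y => by rw [Real.norm_eq_abs, abs_of_nonneg (hI0 y)]; exact hI1 y)
    beta_reduce
    have i1 : Integrable (fun x => (ℓ : ℝ) * Dv T μ e (ℓ * M) x +
        ((ℓ : ℝ) + m) * Dv T μ f ((ℓ + m) * M) (T^[m * c'] x)) μ :=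
      (hDe.const_mul _).add (hDf.const_mul _)
    have i2 : Integrable (fun x => (ℓ : ℝ) * Dv T μ e (ℓ * M) x +
        ((ℓ : ℝ) + m) * Dv T μ f ((ℓ + m) * M) (T^[m * c'] x) +
        ((ℓ : ℝ) + m) * ℓ * Dv T μ g (ℓ * M) x) μ := i1.add (hDg.const_mul _)
    rw [← hDfe, ← integral_mul_const, ← integral_const_mul, ← integral_const_mul,
      ← integral_const_mul, ← integral_add (hDe.const_mul _) (hDf.const_mul _),
      ← integral_add i1 (hDg.const_mul _), ← integral_sub (hIi.mul_const _) i2]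
    refine integral_mono ((hIi.mul_const _).sub i2)
        ((integrable_finsetSum _ fun n _ => hHi n).div_const _) fun x => ?_
    have hlow := H_sum_lower T ℓ m p hp hR E hE F' Y hℓ M c' x
    simp only
    rw [← Finset.mul_sum]
    set H := ∑ n ∈ Finset.range M, Hfun T m (ℓ + m) (fun j => E j ∩ Y) F' (c' + n) (T^[ℓ * n] x)
    have b1 : -(Dv T μ e (ℓ * M) x) ≤
      (∑ t ∈ Finset.range (ℓ * M), e (T^[t] x)) / ((ℓ * M : ℕ) : ℝ) - ∫ x, e x ∂μ := neg_abs_le _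
    have b2 : -(Dv T μ f ((ℓ + m) * M) (T^[m * c'] x)) ≤
      (∑ t ∈ Finset.range ((ℓ + m) * M), f (T^[t] (T^[m * c'] x))) / (((ℓ + m) * M : ℕ) : ℝ) -
        ∫ x, f x ∂μ := neg_abs_le _
    have b3 : (∑ t ∈ Finset.range (ℓ * M), g (T^[t] x)) / ((ℓ * M : ℕ) : ℝ) - ∫ x, g x ∂μ ≤
      Dv T μ g (ℓ * M) x := le_abs_self _
    have n1 : 0 ≤ Dv T μ e (ℓ * M) x := abs_nonneg _
    have n2 : 0 ≤ Dv T μ f ((ℓ + m) * M) (T^[m * c'] x) := abs_nonneg _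
    have n3 : 0 ≤ Dv T μ g (ℓ * M) x := abs_nonneg _
    rw [hei] at b1
    rw [hfi] at b2
    rw [hgi] at b3
    push_cast at b1 b2 b3
    set S1 := ∑ t ∈ Finset.range (ℓ * M), e (T^[t] x) with hS1
    set S2 := ∑ t ∈ Finset.range ((ℓ + m) * M), f (T^[t] (T^[m * c'] x)) with hS2
    set S3 := ∑ t ∈ Finset.range (ℓ * M), g (T^[t] x) with hS3
    have hlow : S1 + S2 - M * (p * ℓ) - (ℓ + m) * S3 ≤ H := hlow
    generalize Dv T μ e (ℓ * M) x = d1 at *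
    generalize Dv T μ f ((ℓ + m) * M) (T^[m * c'] x) = d2 at *
    generalize Dv T μ g (ℓ * M) x = d3 at *
    have k1 : ℓ * (S1 / (ℓ * M)) = S1 / M := by field_simp
    have k2 : ((ℓ : ℝ) + m) * (S2 / ((ℓ + m) * M)) = S2 / M := by field_simp
    have k3 : ((ℓ : ℝ) + m) * ℓ * (S3 / (ℓ * M)) = (ℓ + m) * S3 / M := by field_simp
    have c1 := mul_le_mul_of_nonneg_left b1 hℓ'.le
    have c2 := mul_le_mul_of_nonneg_left b2 hR'.le
    have c3 := mul_le_mul_of_nonneg_left b3 (mul_pos hR' hℓ').le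
    rw [mul_sub, k1] at c1
    rw [mul_sub, k2] at c2
    rw [mul_sub, k3] at c3
    have hH : S1 / M + S2 / M - p * ℓ - (ℓ + m) * S3 / M ≤ H / M := by
      have : S1 / M + S2 / M - p * ℓ - (ℓ + m) * S3 / M =
        (S1 + S2 - M * (p * ℓ) - (ℓ + m) * S3) / M := by field_simp
      rw [this]
      gcongr
    have hD : 0 ≤ ℓ * d1 + (ℓ + m) * d2 + (ℓ + m) * ℓ * d3 := by positivity
    have hfin : β - (ℓ * d1 + (ℓ + m) * d2 + (ℓ + m) * ℓ * d3) ≤ H / M := by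
      rw [hβ]; linarith
    have h8 := mul_le_mul_of_nonneg_left hfin (hI0 x)
    have h9 := mul_le_of_le_one_left hD (hI1 x)
    rw [mul_div_assoc]
    linarith [h8, h9]

end lowerA


section upperB
variable {X : Type*} [MetricSpace X] [CompactSpace X] [MeasurableSpace X] [BorelSpace X]
  {T : X → X} {μ : Measure X}

lemma integrable_bdd [IsProbabilityMeasure μ] {f : X → ℝ} (hf : Measurable f) (C : ℝ)
    (h : ∀ x, |f x| ≤ C) : Integrable f μ :=
  Integrable.of_bound hf.aestronglyMeasurable C (ae_of_all _ h)

lemma slice_int [IsProbabilityMeasure μ] (u : X → X → ℝ) (hu : Measurable (fun q : X × X => u q.1 q.2))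
    (h1 : ∀ x z, |u x z| ≤ 1) (x : X) : Integrable (fun z => u x z) μ :=
  integrable_bdd (f := fun z => u x z)
    (hu.comp (measurable_prodMk_left (x := x))) 1 (h1 x)

lemma slice_int2 [IsProbabilityMeasure μ] (u : X → X → ℝ)
    (hu : Measurable (fun q : X × X => u q.1 q.2))
    (h1 : ∀ x z, |u x z| ≤ 1) : Integrable (fun x => ∫ z, u x z ∂μ) μ := by
  refine integrable_bdd hu.stronglyMeasurable.integral_prod_right.measurable 1 fun x => ?_
  refine (abs_integral_le_integral_abs).trans ?_
  calc _ ≤ ∫ z, (1 : ℝ) ∂μ := integral_mono (slice_int u hu h1 x).abs (integrable_const _) (h1 x)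
    _ = 1 := by simp

/-- one term of the pointwise estimate -/
lemma term_bound (R r : ℕ) (i₀ : ℕ) (hi₀ : i₀ < r) (I τ H : ℝ) (kX ky : ℕ → ℝ) (w g θ ε : ℝ)
    (hI0 : 0 ≤ I) (hH0 : 0 ≤ H) (hHR : H ≤ R)
    (hk : H ≠ 0 → τ ≤ ky i₀) (hw : H ≠ 0 → w = - kX i₀) (hw1 : |w| ≤ 1)
    (hg : |I - g * θ| ≤ ε) :
    τ * (I * H) ≤ R * ∑ i ∈ Finset.range r, I * |kX i - ky i| + R * ε - g * (θ * w * H) := by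
  have hsum : I * |kX i₀ - ky i₀| ≤ ∑ i ∈ Finset.range r, I * |kX i - ky i| :=
    Finset.single_le_sum (f := fun i => I * |kX i - ky i|)
      (fun i _ => mul_nonneg hI0 (abs_nonneg _)) (Finset.mem_range.2 hi₀)
  have hε : 0 ≤ ε := (abs_nonneg _).trans hg
  have h1 : 0 ≤ I * |kX i₀ - ky i₀| := mul_nonneg hI0 (abs_nonneg _)
  have hR : (0 : ℝ) ≤ R := Nat.cast_nonneg R
  by_cases hH : H = 0
  · subst hH
    have : 0 ≤ (R : ℝ) * ∑ i ∈ Finset.range r, I * |kX i - ky i| := mul_nonneg hR (h1.trans hsum)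
    have := mul_nonneg hR hε
    simp only [mul_zero, sub_zero]
    linarith
  · have h2 : τ * (I * H) ≤ ky i₀ * (I * H) :=
      mul_le_mul_of_nonneg_right (hk hH) (mul_nonneg hI0 hH0)
    have h3 : ky i₀ * (I * H) = (ky i₀ - kX i₀) * (I * H) - I * w * H := by rw [hw hH]; ring
    have h4 : (ky i₀ - kX i₀) * (I * H) ≤ I * |kX i₀ - ky i₀| * R := by
      have : ky i₀ - kX i₀ ≤ |kX i₀ - ky i₀| := by rw [abs_sub_comm]; exact le_abs_self _
      calc (ky i₀ - kX i₀) * (I * H) ≤ |kX i₀ - ky i₀| * (I * H) :=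
            mul_le_mul_of_nonneg_right this (mul_nonneg hI0 hH0)
        _ = I * |kX i₀ - ky i₀| * H := by ring
        _ ≤ _ := mul_le_mul_of_nonneg_left hHR h1
    have h5 : -(I * w * H) + g * (θ * w * H) ≤ R * ε := by
      have : -(I * w * H) + g * (θ * w * H) = -((I - g * θ) * w * H) := by ring
      rw [this]
      refine (neg_le_abs _).trans ?_
      rw [abs_mul, abs_mul, abs_of_nonneg hH0]
      calc |I - g * θ| * |w| * H ≤ ε * 1 * R := by gcongr
        _ = R * ε := by ring
    have h6 : I * |kX i₀ - ky i₀| * R ≤ R * ∑ i ∈ Finset.range r, I * |kX i - ky i| := by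
      rw [mul_comm]; gcongr
    linarith

set_option maxHeartbeats 800000 in
lemma upperB [IsProbabilityMeasure μ] (hT : Ergodic T μ) (ℓ m R : ℕ) (hℓ : 0 < ℓ)
    (F' : Set X) (hF' : MeasurableSet F') (A : ℕ → Set X) (hA : ∀ j, MeasurableSet (A j))
    (ρ : X → X → ℝ) (hρ : GoodPM T μ ρ) (r : ℕ) (c : X → ℕ) (hc : Measurable c)
    (hcr : ∀ x, c x < r) (kt : ℕ → X → ℝ) (hk : ∀ i, Measurable[Bsig hT] (kt i))
    (hk0 : ∀ i x, 0 ≤ kt i x) (hk1 : ∀ i x, kt i x ≤ 1)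
    (hw0 : ∀ i, μ[fun x => (c ⁻¹' {i}).indicator (fun _ => (1 : ℝ)) x - kt i x | Bsig hT] =ᵐ[μ] 0)
    (τ : ℝ) (hτ : ∀ j, ∀ y ∈ A j, τ ≤ kt (c y) y) (ε : ℝ) (hε : 0 < ε) :
    ∃ Z : ℕ → X → ℝ, (∀ M, Integrable (Z M) μ) ∧ (∀ M x, 0 ≤ Z M x) ∧
      Tendsto (fun M => ∫ x, Z M x ∂μ) atTop (𝓝 0) ∧
      ∀ M > 0, ∀ x, ∀ c', (∀ n < M, ∀ y, c (T^[ℓ * n] x) = c y → Hfun T m R A F' (c' + n) y = 0) →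
      τ * ((∑ n ∈ Finset.range M, ∫ y, (1 - ρ (T^[ℓ * n] x) y) * Hfun T m R A F' (c' + n) y ∂μ) / M)
      ≤ R * (∑ i ∈ Finset.range r, (∑ n ∈ Finset.range M,
          ∫ y, (1 - ρ (T^[ℓ * n] x) y) * |kt i (T^[ℓ * n] x) - kt i y| ∂μ) / M)
        + 2 * R * ε + Z M x := by
  have hTm : Measurable T := hT.toMeasurePreserving.measurable
  have hkm : ∀ i, Measurable (kt i) := fun i => (hk i).mono (Bsig_le hT) le_rfl
  obtain ⟨S, b, G, hb, hG, hbS, hGε, hGρ⟩ := hρ.tb ε hε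
  have : Nonempty X := nonempty_of_isProbabilityMeasure μ
  set p : ℕ → X := fun s => Classical.epsilon (fun y => y ∈ G ∧ b y = s) with hp
  have hps : ∀ y ∈ G, p (b y) ∈ G ∧ b (p (b y)) = b y := fun y hy =>
    Classical.epsilon_spec (p := fun z => z ∈ G ∧ b z = b y) ⟨y, hy, rfl⟩
  set θ : ℕ → X → ℝ := fun s x => 1 - ρ x (p s) with hθ
  set w : ℕ → X → ℝ := fun i x => (c ⁻¹' {i}).indicator (fun _ => (1 : ℝ)) x - kt i x with hw
  set f : ℕ → X → ℝ := fun j z => F'.indicator (fun _ => (1 : ℝ)) (T^[j] z) with hf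
  have hθB : ∀ s, Measurable[Bsig hT] (θ s) := fun s => theta_meas hT ρ hρ (p s)
  have hθm : ∀ s, Measurable (θ s) := fun s => (hθB s).mono (Bsig_le hT) le_rfl
  have hwm : ∀ i, Measurable (w i) := fun i =>
    (measurable_const.indicator (hc (measurableSet_singleton i))).sub (hkm i)
  have hfm : ∀ j, Measurable (f j) := fun j =>
    (measurable_const.indicator hF').comp (hTm.iterate j)
  have hθ1 : ∀ s x, |θ s x| ≤ 1 := fun s x => by
    have h1 := hρ.nonneg x (p s); have h2 := hρ.le_one x (p s)
    simp only [hθ]; rw [abs_le]; constructor <;> linarith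
  have hw1 : ∀ i x, |w i x| ≤ 1 := fun i x => by
    have h1 := ind_bounds (c ⁻¹' {i}) x
    have h2 := hk0 i x; have h3 := hk1 i x
    simp only [hw]; rw [abs_le]; constructor <;> linarith [h1.1, h1.2]
  have hf1 : ∀ j x, |f j x| ≤ 1 := fun j x => by
    have h1 := ind_bounds F' (T^[j] x)
    simp only [hf]; rw [abs_of_nonneg h1.1]; exact h1.2
  set u : ℕ → ℕ → ℕ → ℕ → X → X → ℝ := fun s i j M x z =>
    |(∑ n ∈ Finset.range M, θ s (T^[ℓ * n] x) * w i (T^[ℓ * n] x) * f j (T^[m * n] z)) / M| with hu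
  have hum : ∀ s i j M, Measurable (fun q : X × X => u s i j M q.1 q.2) := by
    intro s i j M
    refine Measurable.abs (Measurable.div_const (Finset.measurable_fun_sum _ fun n _ => ?_) _)
    exact ((((hθm s).comp ((hTm.iterate _).comp measurable_fst)).mul
      ((hwm i).comp ((hTm.iterate _).comp measurable_fst)))).mul
      ((hfm j).comp ((hTm.iterate _).comp measurable_snd))
  have hu1 : ∀ s i j M x z, |u s i j M x z| ≤ 1 := by
    intro s i j M x z
    simp only [hu]
    rw [abs_abs, abs_div, Nat.abs_cast]
    refine div_le_one_of_le₀ ?_ (Nat.cast_nonneg _)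
    refine (Finset.abs_sum_le_sum_abs _ _).trans ?_
    calc _ ≤ ∑ n ∈ Finset.range M, (1 : ℝ) := Finset.sum_le_sum fun n _ => by
          rw [abs_mul, abs_mul]
          exact mul_le_one₀ (mul_le_one₀ (hθ1 _ _) (abs_nonneg _) (hw1 _ _)) (abs_nonneg _) (hf1 _ _)
      _ = M := by simp
  have hu0 : ∀ s i j M x z, 0 ≤ u s i j M x z := fun s i j M x z => abs_nonneg _
  have huz : ∀ s i j M x, Integrable (fun z => u s i j M x z) μ := fun s i j M x =>
    slice_int (u s i j M) (hum s i j M) (hu1 s i j M) x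
  have huI : ∀ s i j M, Integrable (fun x => ∫ z, u s i j M x z ∂μ) μ := fun s i j M =>
    slice_int2 (u s i j M) (hum s i j M) (hu1 s i j M)
  refine ⟨fun M x => ∑ s ∈ Finset.range S, ∑ i ∈ Finset.range r, ∑ j ∈ Finset.range R,
    ∫ z, u s i j M x z ∂μ, ?_, ?_, ?_, ?_⟩
  · intro M
    exact integrable_finsetSum _ fun s _ => integrable_finsetSum _ fun i _ =>
      integrable_finsetSum _ fun j _ => huI s i j M
  · exact fun M x => Finset.sum_nonneg fun s _ => Finset.sum_nonneg fun i _ =>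
      Finset.sum_nonneg fun j _ => integral_nonneg fun z => hu0 s i j M x z
  · have : ∀ M, ∫ x, (∑ s ∈ Finset.range S, ∑ i ∈ Finset.range r, ∑ j ∈ Finset.range R,
        ∫ z, u s i j M x z ∂μ) ∂μ = ∑ s ∈ Finset.range S, ∑ i ∈ Finset.range r,
          ∑ j ∈ Finset.range R, ∫ x, ∫ z, u s i j M x z ∂μ ∂μ := by
      intro M
      rw [integral_finsetSum _ fun s _ => integrable_finsetSum _ fun i _ =>
        integrable_finsetSum _ fun j _ => huI s i j M]
      refine Finset.sum_congr rfl fun s _ => ?_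
      rw [integral_finsetSum _ fun i _ => integrable_finsetSum _ fun j _ => huI s i j M]
      refine Finset.sum_congr rfl fun i _ => ?_
      rw [integral_finsetSum _ fun j _ => huI s i j M]
    simp only [this]
    have hz : (0 : ℝ) = ∑ s ∈ Finset.range S, ∑ i ∈ Finset.range r,
          ∑ j ∈ Finset.range R, (0 : ℝ) := by simp
    rw [hz]
    refine tendsto_finsetSum _ fun s _ => tendsto_finsetSum _ fun i _ =>
      tendsto_finsetSum _ fun j _ => ?_
    exact decor hT ℓ m hℓ (w i) (θ s) (f j) (hwm i) (hw1 i) (hw0 i) (hθB s) (hθ1 s) (hfm j) (hf1 j)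
  · intro M hM x c' hvan
    have hM' : (0 : ℝ) < M := by exact_mod_cast hM
    have hpt : ∀ y, τ * ((∑ n ∈ Finset.range M,
        (1 - ρ (T^[ℓ * n] x) y) * Hfun T m R A F' (c' + n) y) / M)
      ≤ R * (∑ i ∈ Finset.range r, (∑ n ∈ Finset.range M,
          (1 - ρ (T^[ℓ * n] x) y) * |kt i (T^[ℓ * n] x) - kt i y|) / M)
        + R * (ε + Gᶜ.indicator (fun _ => (1 : ℝ)) y)
        + ∑ s ∈ Finset.range S, ∑ i ∈ Finset.range r, ∑ j ∈ Finset.range R,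
          u s i j M x (T^[m * c'] y) := by
      intro y
      set g : ℝ := G.indicator (fun _ => (1 : ℝ)) y with hgd
      have hterm : ∀ n ∈ Finset.range M, τ * ((1 - ρ (T^[ℓ * n] x) y) * Hfun T m R A F' (c' + n) y) ≤
          R * ∑ i ∈ Finset.range r, (1 - ρ (T^[ℓ * n] x) y) * |kt i (T^[ℓ * n] x) - kt i y|
          + R * (ε + Gᶜ.indicator (fun _ => (1 : ℝ)) y)
          - g * (θ (b y) (T^[ℓ * n] x) * w (c y) (T^[ℓ * n] x) * Hfun T m R A F' (c' + n) y) := by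
        intro n hn
        have hn := Finset.mem_range.1 hn
        have hH := Hfun_bounds T m R A F' (c' + n) y
        refine term_bound R r (c y) (hcr y) _ τ _ (fun i => kt i (T^[ℓ * n] x)) (fun i => kt i y)
          _ g _ _ ?_ hH.1 hH.2 ?_ ?_ (hw1 _ _) ?_
        · linarith [hρ.le_one (T^[ℓ * n] x) y]
        · intro hne
          have : ∃ j, y ∈ A j := by
            by_contra hcon
            push Not at hcon
            apply hne
            unfold Hfun
            exact Finset.sum_eq_zero fun j _ => by rw [Set.indicator_of_notMem (hcon j), zero_mul]
          obtain ⟨j, hj⟩ := this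
          exact hτ j y hj
        · intro hne
          have h1 : c (T^[ℓ * n] x) ≠ c y := fun h => hne (hvan n hn y h)
          simp only [hw]
          rw [Set.indicator_of_notMem (by simpa using h1)]
          ring
        · by_cases hy : y ∈ G
          · have h2 := hps y hy
            have h3 := hGρ _ h2.1 y hy h2.2
            rw [hgd, Set.indicator_of_mem hy, Set.indicator_of_notMem (by simpa using hy)]
            simp only [hθ]
            have h4 := hρ.abs_sub_le (p (b y)) y (T^[ℓ * n] x)
            rw [hρ.symm _ (T^[ℓ * n] x), hρ.symm _ (T^[ℓ * n] x)] at h4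
            have h5 : 1 - ρ (T^[ℓ * n] x) y - 1 * (1 - ρ (T^[ℓ * n] x) (p (b y))) =
              ρ (T^[ℓ * n] x) (p (b y)) - ρ (T^[ℓ * n] x) y := by ring
            rw [h5]
            linarith
          · rw [hgd, Set.indicator_of_notMem hy, Set.indicator_of_mem (by simpa using hy)]
            have h1 := hρ.nonneg (T^[ℓ * n] x) y
            have h2 := hρ.le_one (T^[ℓ * n] x) y
            rw [zero_mul, sub_zero, abs_of_nonneg (by linarith)]
            linarith
      have hsum := Finset.sum_le_sum hterm
      rw [Finset.sum_sub_distrib, Finset.sum_add_distrib, ← Finset.mul_sum, ← Finset.mul_sum,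
        ← Finset.mul_sum, Finset.sum_const, Finset.card_range, nsmul_eq_mul] at hsum
      have hlast : -(g * (∑ n ∈ Finset.range M,
          θ (b y) (T^[ℓ * n] x) * w (c y) (T^[ℓ * n] x) * Hfun T m R A F' (c' + n) y)) / M ≤
          ∑ s ∈ Finset.range S, ∑ i ∈ Finset.range r, ∑ j ∈ Finset.range R,
          u s i j M x (T^[m * c'] y) := by
        have e1 : -(g * (∑ n ∈ Finset.range M,
          θ (b y) (T^[ℓ * n] x) * w (c y) (T^[ℓ * n] x) * Hfun T m R A F' (c' + n) y)) / M =
          ∑ j ∈ Finset.range R, -(g * (A j).indicator (fun _ => (1 : ℝ)) y) *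
            ((∑ n ∈ Finset.range M, θ (b y) (T^[ℓ * n] x) * w (c y) (T^[ℓ * n] x) *
              f j (T^[m * n] (T^[m * c'] y))) / M) := by
          have e2 : ∀ n, T^[m * n] (T^[m * c'] y) = T^[m * (c' + n)] y := by
            intro n
            rw [← Function.iterate_add_apply]; congr 1; ring
          simp only [Hfun, hf, e2, Finset.mul_sum, Finset.sum_div, ← Finset.sum_neg_distrib]
          rw [Finset.sum_comm]
          refine Finset.sum_congr rfl fun j _ => Finset.sum_congr rfl fun n _ => ?_
          ring
        rw [e1]
        calc _ ≤ ∑ j ∈ Finset.range R, u (b y) (c y) j M x (T^[m * c'] y) := by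
              refine Finset.sum_le_sum fun j _ => (le_abs_self _).trans ?_
              rw [abs_mul, abs_neg]
              refine mul_le_of_le_one_left (abs_nonneg _) ?_
              rw [abs_of_nonneg (mul_nonneg (ind_bounds _ _).1 (ind_bounds _ _).1)]
              exact mul_le_one₀ (ind_bounds _ _).2 (ind_bounds _ _).1 (ind_bounds _ _).2
          _ ≤ ∑ i ∈ Finset.range r, ∑ j ∈ Finset.range R, u (b y) i j M x (T^[m * c'] y) :=
              Finset.single_le_sum
                (f := fun i => ∑ j ∈ Finset.range R, u (b y) i j M x (T^[m * c'] y))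
                (fun i _ => Finset.sum_nonneg fun j _ => hu0 _ _ _ _ _ _)
                (Finset.mem_range.2 (hcr y))
          _ ≤ _ := Finset.single_le_sum
                (f := fun s => ∑ i ∈ Finset.range r, ∑ j ∈ Finset.range R,
                  u s i j M x (T^[m * c'] y))
                (fun s _ => Finset.sum_nonneg fun i _ => Finset.sum_nonneg fun j _ =>
                  hu0 _ _ _ _ _ _) (Finset.mem_range.2 (hbS y))
      have hdiv := div_le_div_of_nonneg_right hsum hM'.le
      rw [mul_div_assoc, sub_div, add_div, mul_div_assoc, mul_div_assoc,
        mul_div_cancel_left₀ _ hM'.ne', Finset.sum_comm] at hdiv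
      rw [neg_div] at hlast
      rw [← Finset.sum_div]
      have hgm := Finset.mul_sum (Finset.range M) (fun n => θ (b y) (T^[ℓ * n] x) *
        w (c y) (T^[ℓ * n] x) * Hfun T m R A F' (c' + n) y) g
      beta_reduce at hgm
      try rw [← hgm] at hdiv
      linarith
    have hHm : ∀ n, Measurable (Hfun T m R A F' n) := fun n => Hfun_meas hTm m R A hA F' hF' n
    have hI1 : ∀ n, Integrable (fun y => (1 - ρ (T^[ℓ * n] x) y) * Hfun T m R A F' (c' + n) y) μ := by
      intro n
      refine integrable_bdd (((hρ.meas_right _).const_sub 1).mul (hHm _)) R fun y => ?_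
      have hH := Hfun_bounds T m R A F' (c' + n) y
      have h1 := hρ.nonneg (T^[ℓ * n] x) y
      have h2 := hρ.le_one (T^[ℓ * n] x) y
      rw [abs_of_nonneg (mul_nonneg (by linarith) hH.1)]
      exact (mul_le_of_le_one_left hH.1 (by linarith)).trans hH.2
    have hI2 : ∀ i n, Integrable (fun y => (1 - ρ (T^[ℓ * n] x) y) *
        |kt i (T^[ℓ * n] x) - kt i y|) μ := by
      intro i n
      refine integrable_bdd (((hρ.meas_right _).const_sub 1).mul ((hkm i).const_sub _).abs) 1
        fun y => ?_
      have h1 := hρ.nonneg (T^[ℓ * n] x) y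
      have h2 := hρ.le_one (T^[ℓ * n] x) y
      have h3 : |kt i (T^[ℓ * n] x) - kt i y| ≤ 1 := by
        rw [abs_le]; constructor <;>
          linarith [hk0 i y, hk1 i y, hk0 i (T^[ℓ * n] x), hk1 i (T^[ℓ * n] x)]
      rw [abs_mul, abs_abs]
      exact mul_le_one₀ (by rw [abs_of_nonneg] <;> linarith) (abs_nonneg _) h3
    have hmp : MeasurePreserving T^[m * c'] μ μ := hT.toMeasurePreserving.iterate _
    have hI3 : ∀ s i j, Integrable (fun y => u s i j M x (T^[m * c'] y)) μ := fun s i j =>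
      hmp.integrable_comp_of_integrable (huz s i j M x)
    have hI3e : ∀ s i j, ∫ y, u s i j M x (T^[m * c'] y) ∂μ = ∫ z, u s i j M x z ∂μ := by
      intro s i j
      have hasm : AEStronglyMeasurable (fun z => u s i j M x z) (μ.map T^[m * c']) := by
        rw [hmp.map_eq]; exact (huz s i j M x).aestronglyMeasurable
      rw [← integral_map hmp.measurable.aemeasurable hasm, hmp.map_eq]
    have hIL : Integrable (fun y => τ * ((∑ n ∈ Finset.range M,
        (1 - ρ (T^[ℓ * n] x) y) * Hfun T m R A F' (c' + n) y) / M)) μ :=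
      ((integrable_finsetSum _ fun n _ => hI1 n).div_const _).const_mul _
    have hIa : Integrable (fun y => R * (∑ i ∈ Finset.range r, (∑ n ∈ Finset.range M,
          (1 - ρ (T^[ℓ * n] x) y) * |kt i (T^[ℓ * n] x) - kt i y|) / M)) μ :=
      (integrable_finsetSum _ fun i _ =>
        (integrable_finsetSum _ fun n _ => hI2 i n).div_const _).const_mul _
    have hGi : Integrable (Gᶜ.indicator (fun _ => (1 : ℝ))) μ :=
      (integrable_const _).indicator hG.compl
    have hIb : Integrable (fun y => R * (ε + Gᶜ.indicator (fun _ => (1 : ℝ)) y)) μ :=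
      ((integrable_const _).add hGi).const_mul _
    have hIc : Integrable (fun y => ∑ s ∈ Finset.range S, ∑ i ∈ Finset.range r,
        ∑ j ∈ Finset.range R, u s i j M x (T^[m * c'] y)) μ :=
      integrable_finsetSum _ fun s _ => integrable_finsetSum _ fun i _ =>
        integrable_finsetSum _ fun j _ => hI3 s i j
    have hmono := integral_mono hIL ((hIa.add hIb).add hIc) hpt
    have hadd : ∫ y, ((R * (∑ i ∈ Finset.range r, (∑ n ∈ Finset.range M,
          (1 - ρ (T^[ℓ * n] x) y) * |kt i (T^[ℓ * n] x) - kt i y|) / M)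
        + R * (ε + Gᶜ.indicator (fun _ => (1 : ℝ)) y)
        + ∑ s ∈ Finset.range S, ∑ i ∈ Finset.range r, ∑ j ∈ Finset.range R,
          u s i j M x (T^[m * c'] y))) ∂μ = _ :=
      (integral_add (hIa.add hIb) hIc).trans (congrArg (· + _) (integral_add hIa hIb))
    have hmono := hmono.trans (le_of_eq hadd)
    rw [integral_const_mul, integral_div, integral_finsetSum _ fun n _ => hI1 n,
      integral_const_mul, integral_finsetSum _ fun i _ =>
        (integrable_finsetSum _ fun n _ => hI2 i n).div_const _, integral_const_mul] at hmono
    have hG2 : ∫ y, (ε + Gᶜ.indicator (fun _ => (1 : ℝ)) y) ∂μ ≤ 2 * ε := by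
      rw [integral_add (integrable_const _) hGi, integral_indicator_const _ hG.compl]
      simp only [integral_const, probReal_univ, one_smul, smul_eq_mul, mul_one]
      linarith
    have hG3 := mul_le_mul_of_nonneg_left hG2 (Nat.cast_nonneg (α := ℝ) R)
    have hc3 : ∫ y, (∑ s ∈ Finset.range S, ∑ i ∈ Finset.range r,
        ∑ j ∈ Finset.range R, u s i j M x (T^[m * c'] y)) ∂μ = ∑ s ∈ Finset.range S,
        ∑ i ∈ Finset.range r, ∑ j ∈ Finset.range R, ∫ z, u s i j M x z ∂μ := by
      rw [integral_finsetSum _ fun s _ => integrable_finsetSum _ fun i _ =>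
        integrable_finsetSum _ fun j _ => hI3 s i j]
      refine Finset.sum_congr rfl fun s _ => ?_
      rw [integral_finsetSum _ fun i _ => integrable_finsetSum _ fun j _ => hI3 s i j]
      refine Finset.sum_congr rfl fun i _ => ?_
      rw [integral_finsetSum _ fun j _ => hI3 s i j]
      exact Finset.sum_congr rfl fun j _ => hI3e s i j
    have hc2 : ∀ i, ∫ y, (∑ n ∈ Finset.range M,
          (1 - ρ (T^[ℓ * n] x) y) * |kt i (T^[ℓ * n] x) - kt i y|) / M ∂μ =
        (∑ n ∈ Finset.range M,
          ∫ y, (1 - ρ (T^[ℓ * n] x) y) * |kt i (T^[ℓ * n] x) - kt i y| ∂μ) / M := by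
      intro i
      rw [integral_div, integral_finsetSum _ fun n _ => hI2 i n]
    rw [hc3] at hmono
    simp only [hc2] at hmono
    linarith

end upperB


section corelem

/-- truncated version of the conditional probability of a set -/
lemma trunc_condExp {X : Type*} {m0 : MeasurableSpace X} {μ : Measure X} [IsProbabilityMeasure μ]
    (B : MeasurableSpace X) (hB : B ≤ m0) (K : Set X) (hK : MeasurableSet[m0] K) :
    ∃ k : X → ℝ, Measurable[B] k ∧ (∀ x, 0 ≤ k x) ∧ (∀ x, k x ≤ 1) ∧
      μ[fun x => K.indicator (fun _ => (1 : ℝ)) x - k x | B] =ᵐ[μ] 0 ∧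
      ∀ τ : ℝ, 0 ≤ τ → μ.real (K ∩ {x | k x < τ}) ≤ τ := by
  set f : X → ℝ := K.indicator (fun _ => (1 : ℝ)) with hf
  have hfi : Integrable f μ := (integrable_const _).indicator hK
  set e : X → ℝ := μ[f | B] with he
  have hem : Measurable[B] e := stronglyMeasurable_condExp.measurable
  have h0 : ∀ᵐ x ∂μ, 0 ≤ e x := condExp_nonneg (ae_of_all _ fun x => (ind_bounds K x).1)
  have h1 : ∀ᵐ x ∂μ, e x ≤ 1 := by
    have := condExp_mono (m := B) hfi (integrable_const (1 : ℝ))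
      (ae_of_all _ fun x => (ind_bounds K x).2)
    rw [condExp_const hB] at this
    exact this
  have hkm : Measurable[B] (fun x => max 0 (min 1 (e x))) := by
    have hφ : Measurable (fun t : ℝ => max 0 (min 1 t)) := by fun_prop
    exact hφ.comp hem
  have hke : (fun x => max 0 (min 1 (e x))) =ᵐ[μ] e := by
    filter_upwards [h0, h1] with x a b
    rw [min_eq_right b, max_eq_right a]
  set k : X → ℝ := fun x => max 0 (min 1 (e x)) with hk
  have hk0 : ∀ x, 0 ≤ k x := fun x => le_max_left _ _
  have hk1 : ∀ x, k x ≤ 1 := fun x => max_le zero_le_one (min_le_left _ _)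
  have hki : Integrable k μ := Integrable.of_bound (hkm.mono hB le_rfl).aestronglyMeasurable 1
    (ae_of_all _ fun x => by rw [Real.norm_eq_abs, abs_of_nonneg (hk0 x)]; exact hk1 x)
  refine ⟨k, hkm, hk0, hk1, ?_, ?_⟩
  · have h2 := condExp_sub hfi hki B
    rw [condExp_of_stronglyMeasurable hB hkm.stronglyMeasurable hki] at h2
    have h3 : (fun x => f x - k x) = f - k := rfl
    rw [h3]
    filter_upwards [h2, hke] with x a b
    rw [a]
    simp only [Pi.sub_apply, Pi.zero_apply]
    rw [b]; simp [he]
  · intro τ hτ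
    have hs : MeasurableSet[B] {x | k x < τ} := hkm measurableSet_Iio
    have hs' : MeasurableSet[m0] {x | k x < τ} := hB _ hs
    have h4 := setIntegral_condExp hB hfi hs
    have h5 : ∫ x in {x | k x < τ}, f x ∂μ = μ.real (K ∩ {x | k x < τ}) := by
      rw [hf, integral_indicator hK, Measure.restrict_restrict hK]
      simp
    have h6 : ∫ x in {x | k x < τ}, e x ∂μ = ∫ x in {x | k x < τ}, k x ∂μ :=
      setIntegral_congr_ae hs' (hke.mono fun x hx _ => hx.symm)
    rw [← h5, ← h4, h6]
    calc ∫ x in {x | k x < τ}, k x ∂μ ≤ ∫ x in {x | k x < τ}, τ ∂μ :=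
          setIntegral_mono_on hki.integrableOn (integrable_const _) hs' fun x hx => le_of_lt hx
      _ = μ.real {x | k x < τ} * τ := by simp
      _ ≤ 1 * τ := mul_le_mul_of_nonneg_right measureReal_le_one hτ
      _ = τ := one_mul _

variable {X : Type*} [MetricSpace X] [CompactSpace X] [MeasurableSpace X] [BorelSpace X]
  {T : X → X} {μ : Measure X}

lemma exists_time (hTc : Continuous T) (a x : X) (ℓ k : ℕ)
    (hx : MapClusterPt x atTop (fun n => T^[ℓ * n] a)) (κ : ℝ) (hκ : 0 < κ) (M : ℕ) :
    ∃ c' ≥ k, ∀ n < M, dist (T^[ℓ * (c' + n)] a) (T^[ℓ * n] x) < κ := by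
  have hnb : ∀ᶠ z in 𝓝 x, ∀ n ∈ Finset.range M, dist (T^[ℓ * n] z) (T^[ℓ * n] x) < κ := by
    rw [Filter.eventually_all_finset]
    intro n _
    exact (hTc.iterate (ℓ * n)).continuousAt (Metric.ball_mem_nhds _ hκ)
  have hfr := (mapClusterPt_iff_frequently.1 hx) _ hnb
  obtain ⟨c', hc', h⟩ := (Filter.frequently_atTop.1 hfr) k
  refine ⟨c', hc', fun n hn => ?_⟩
  have := h n (Finset.mem_range.2 hn)
  rw [← Function.iterate_add_apply] at this
  have e : ℓ * (c' + n) = ℓ * n + ℓ * c' := by ring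
  rwa [e]

lemma rho_iter {ρ : X → X → ℝ} (hρ : GoodPM T μ ρ) (n : ℕ) (x y : X) :
    ρ (T^[n] x) (T^[n] y) = ρ x y := by
  induction n with
  | zero => rfl
  | succ n ih => rw [Function.iterate_succ_apply', Function.iterate_succ_apply', hρ.inv, ih]

set_option maxHeartbeats 800000 in
lemma core [IsProbabilityMeasure μ] (hTc : Continuous T) (hT : Ergodic T μ)
    {a : X} {Φ : ℕ → Finset ℕ} (hΦ : IsFolnerSeq Φ) (ha : GenericAlong T μ a Φ)
    (ℓ m p : ℕ) (hℓ : 0 < ℓ) (hp : 0 < p) (hR : ℓ + m ≤ p * ℓ)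
    (E : ℕ → Set X) (hE : ∀ i, i + p < ℓ + m → E (i + p) = T ⁻¹' E i)
    (hEm : ∀ i, MeasurableSet (E i)) (F' Y0 : Set X) (hF' : MeasurableSet F')
    (hY0 : MeasurableSet Y0) (k : ℕ) (κ : ℝ) (hκ : 0 < κ)
    (hY : ∀ y ∈ Y0, ∀ N ≥ k, dist (T^[ℓ * N] a) y < 2 * κ → ∀ j < ℓ + m, y ∈ E j →
      T^[j] (T^[m * N] y) ∉ F')
    (hβ : 0 < ℓ * ∑ i ∈ Finset.range p, μ.real (E i) + (ℓ + m) * μ.real F' - p * ℓ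
        - (ℓ + m) * ℓ * μ.real Y0ᶜ) : False := by
  have : Nonempty X := ⟨a⟩
  have hTm : Measurable T := hTc.measurable
  obtain ⟨r, c, hc, hcr, hcd⟩ := exists_cells (X := X) κ hκ
  have hrpos : 0 < r := (Nat.zero_le _).trans_lt (hcr a)
  set β0 := ℓ * ∑ i ∈ Finset.range p, μ.real (E i) + (ℓ + m) * μ.real F' - p * ℓ
        - (ℓ + m) * ℓ * μ.real Y0ᶜ with hβ0
  have hKm : ∀ i, MeasurableSet (c ⁻¹' {i}) := fun i => hc (measurableSet_singleton i)
  choose kt hk hk0 hk1 hw0 hsmall using fun i =>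
    trunc_condExp (μ := μ) (Bsig hT) (Bsig_le hT) (c ⁻¹' {i}) (hKm i)
  have hkm : ∀ i, Measurable (kt i) := fun i => (hk i).mono (Bsig_le hT) le_rfl
  have hℓ' : (0 : ℝ) < ℓ := by exact_mod_cast hℓ
  have hr' : (0 : ℝ) < r := by exact_mod_cast hrpos
  have hR' : (0 : ℝ) < (ℓ : ℝ) + m := by positivity
  set τ : ℝ := β0 / (2 * ((ℓ + m) * ℓ * r)) with hτd
  have hτ : 0 < τ := by positivity
  set V : Set X := ⋃ i ∈ Finset.range r, (c ⁻¹' {i} ∩ {x | kt i x < τ}) with hV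
  have hVm : MeasurableSet V := Finset.measurableSet_biUnion _ fun i _ =>
    (hKm i).inter (hkm i measurableSet_Iio)
  have hVμ : μ.real V ≤ r * τ := by
    calc μ.real V ≤ ∑ i ∈ Finset.range r, μ.real (c ⁻¹' {i} ∩ {x | kt i x < τ}) :=
          measureReal_biUnion_finset_le _ _
      _ ≤ ∑ i ∈ Finset.range r, τ := Finset.sum_le_sum fun i _ => hsmall i τ hτ.le
      _ = r * τ := by simp
  set Y := Y0 \ V with hYd
  have hYm : MeasurableSet Y := hY0.diff hVm
  have hYμ : μ.real Yᶜ ≤ μ.real Y0ᶜ + r * τ := by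
    have : Yᶜ = Y0ᶜ ∪ V := by
      rw [hYd, Set.compl_sdiff, Set.union_comm]
    rw [this]
    exact (measureReal_union_le _ _).trans (by linarith)
  set β' := ℓ * ∑ i ∈ Finset.range p, μ.real (E i) + (ℓ + m) * μ.real F' - p * ℓ
        - (ℓ + m) * ℓ * μ.real Yᶜ with hβ'
  have hββ : β0 / 2 ≤ β' := by
    have h1 : ((ℓ : ℝ) + m) * ℓ * μ.real Yᶜ ≤ (ℓ + m) * ℓ * (μ.real Y0ᶜ + r * τ) := by gcongr
    have h2 : ((ℓ : ℝ) + m) * ℓ * (r * τ) = β0 / 2 := by rw [hτd]; field_simp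
    rw [mul_add, h2] at h1
    linarith
  have hβ'pos : 0 < β' := by linarith
  set η : ℝ := τ * β' / (4 * ℓ * (ℓ + m) * r) with hηd
  have hη : 0 < η := by positivity
  choose ρ₀ hρ₀ hconc using fun i => concentration hT (kt i) (hk i) (hk0 i) (hk1 i) η hη
  obtain ⟨ρ, hρ, hρle⟩ := GoodPM.finite_sup ρ₀ hρ₀ r
  have hd := hρ.dens_pos hT
  set d := dens μ ρ with hdd
  set ε : ℝ := τ * d * β' / (8 * (ℓ + m) * ℓ) with hεd
  have hε : 0 < ε := by positivity
  obtain ⟨err, herr, hlow⟩ := lowerA hT ℓ m p hp hR hℓ E hE hEm F' Y hF' hYm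
  have hAm : ∀ j, MeasurableSet (E j ∩ Y) := fun j => (hEm j).inter hYm
  obtain ⟨Z, hZi, hZ0, hZlim, hup⟩ := upperB hT ℓ m (ℓ + m) hℓ F' hF' (fun j => E j ∩ Y) hAm ρ hρ
    r c hc hcr kt hk hk0 hk1 hw0 τ (by
      intro j y hy
      by_contra hlt
      push Not at hlt
      refine hy.2.2 ?_
      rw [hV]
      exact Set.mem_biUnion (Finset.mem_coe.2 (Finset.mem_range.2 (hcr y))) ⟨rfl, hlt⟩) ε hε
  obtain ⟨Ω, hΩ, hΩμ, hΩc⟩ := omega_measure hTc hT.toMeasurePreserving hΦ ha ℓ hℓ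
  set Ξ : ℕ → X → ℝ := fun i x => ∫ y, (1 - ρ x y) * |kt i x - kt i y| ∂μ with hΞ
  have hum : ∀ i, Measurable (fun q : X × X => (1 - ρ q.1 q.2) * |kt i q.1 - kt i q.2|) := fun i =>
    (hρ.meas.const_sub 1).mul (((hkm i).comp measurable_fst).sub ((hkm i).comp measurable_snd)).abs
  have hρ01 : ∀ x y, 0 ≤ 1 - ρ x y := fun x y => by linarith [hρ.le_one x y]
  have hu1 : ∀ i x y, |(1 - ρ x y) * (|kt i x - kt i y|)| ≤ 1 := by
    intro i x y
    have h3 : |kt i x - kt i y| ≤ 1 := by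
      rw [abs_le]; constructor <;> linarith [hk0 i y, hk1 i y, hk0 i x, hk1 i x]
    rw [abs_mul, abs_abs, abs_of_nonneg (hρ01 x y)]
    exact mul_le_one₀ (by linarith [hρ.nonneg x y]) (abs_nonneg _) h3
  have hΞi : ∀ i, Integrable (Ξ i) μ := fun i =>
    slice_int2 (fun x y => (1 - ρ x y) * |kt i x - kt i y|) (hum i) (hu1 i)
  have hΞ0 : ∀ i x, 0 ≤ Ξ i x := fun i x =>
    integral_nonneg fun y => mul_nonneg (hρ01 x y) (abs_nonneg _)
  have hΞle : ∀ i < r, ∫ x, Ξ i x ∂μ ≤ η * d := fun i hi => hconc i ρ hρ (hρle i hi)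
  have hmp : ∀ n, MeasurePreserving T^[n] μ μ := fun n => hT.toMeasurePreserving.iterate n
  have hΞTi : ∀ i n, Integrable (fun x => Ξ i (T^[n] x)) μ := fun i n =>
    (hmp n).integrable_comp_of_integrable (hΞi i)
  have hΞTe : ∀ i n, ∫ x, Ξ i (T^[n] x) ∂μ = ∫ x, Ξ i x ∂μ := by
    intro i n
    have hasm : AEStronglyMeasurable (Ξ i) (μ.map T^[n]) := by
      rw [(hmp n).map_eq]; exact (hΞi i).aestronglyMeasurable
    rw [← integral_map (hmp n).measurable.aemeasurable hasm, (hmp n).map_eq]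
  -- pointwise inequality on Ω
  have hmain : ∀ M > 0, ∀ᵐ x ∂μ, x ∈ Ω → τ * (d * β' - err M) ≤
      ((ℓ + m : ℕ) : ℝ) * (∑ i ∈ Finset.range r, (∑ n ∈ Finset.range M, Ξ i (T^[ℓ * n] x)) / M)
        + 2 * ((ℓ + m : ℕ) : ℝ) * ε + Z M x := by
    intro M hM
    filter_upwards [hρ.row hT] with x hx hxΩ
    obtain ⟨c', hc', hdist⟩ := exists_time hTc a x ℓ k (hΩc x hxΩ) κ hκ M
    have hB := hup M hM x c' (by
      intro n hn y hcy
      unfold Hfun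
      refine Finset.sum_eq_zero fun j hj => ?_
      by_cases hy : y ∈ E j ∩ Y
      · have h1 : dist (T^[ℓ * (c' + n)] a) y < 2 * κ := by
          have := dist_triangle (T^[ℓ * (c' + n)] a) (T^[ℓ * n] x) y
          linarith [hdist n hn, hcd _ _ hcy]
        have h2 := hY y hy.2.1 (c' + n) (by omega) h1 j (Finset.mem_range.1 hj) hy.1
        rw [Set.indicator_of_notMem h2, mul_zero]
      · rw [Set.indicator_of_notMem hy, zero_mul])
    have hA := hlow M hM c' (fun x' => 1 - ρ x x') ((hρ.meas_right x).const_sub 1) (hρ01 x)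
      (fun x' => by linarith [hρ.nonneg x x'])
    rw [hx] at hA
    have hlink : ∀ n, ∫ x', (1 - ρ x x') *
        Hfun T m (ℓ + m) (fun j => E j ∩ Y) F' (c' + n) (T^[ℓ * n] x') ∂μ =
        ∫ y, (1 - ρ (T^[ℓ * n] x) y) * Hfun T m (ℓ + m) (fun j => E j ∩ Y) F' (c' + n) y ∂μ := by
      intro n
      have hms : Measurable (fun y => (1 - ρ (T^[ℓ * n] x) y) *
          Hfun T m (ℓ + m) (fun j => E j ∩ Y) F' (c' + n) y) :=
        ((hρ.meas_right _).const_sub 1).mul (Hfun_meas hTm m _ _ hAm F' hF' _)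
      have h1 := integral_map (μ := μ) (hmp (ℓ * n)).measurable.aemeasurable
        (f := fun y => (1 - ρ (T^[ℓ * n] x) y) *
          Hfun T m (ℓ + m) (fun j => E j ∩ Y) F' (c' + n) y) hms.aestronglyMeasurable
      rw [(hmp (ℓ * n)).map_eq] at h1
      rw [h1]
      simp only [rho_iter hρ]
    simp only [hlink] at hA
    exact (mul_le_mul_of_nonneg_left hA hτ.le).trans hB
  have hIntg : ∀ M > 0, μ.real Ω * (τ * (d * β' - err M)) ≤
      ((ℓ : ℝ) + m) * (r * (η * d)) + 2 * (ℓ + m) * ε + ∫ x, Z M x ∂μ := by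
    intro M hM
    have hM' : (0 : ℝ) < M := by exact_mod_cast hM
    have i1 : Integrable (fun x => ((ℓ + m : ℕ) : ℝ) *
        (∑ i ∈ Finset.range r, (∑ n ∈ Finset.range M, Ξ i (T^[ℓ * n] x)) / M)) μ :=
      (integrable_finsetSum _ fun i _ =>
        (integrable_finsetSum _ fun n _ => hΞTi i (ℓ * n)).div_const _).const_mul _
    have i2 : Integrable (fun x => ((ℓ + m : ℕ) : ℝ) *
        (∑ i ∈ Finset.range r, (∑ n ∈ Finset.range M, Ξ i (T^[ℓ * n] x)) / M)
        + 2 * ((ℓ + m : ℕ) : ℝ) * ε) μ := i1.add (integrable_const _)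
    have i3 : Integrable (fun x => ((ℓ + m : ℕ) : ℝ) *
        (∑ i ∈ Finset.range r, (∑ n ∈ Finset.range M, Ξ i (T^[ℓ * n] x)) / M)
        + 2 * ((ℓ + m : ℕ) : ℝ) * ε + Z M x) μ := i2.add (hZi M)
    have hs1 : μ.real Ω * (τ * (d * β' - err M)) = ∫ x in Ω, τ * (d * β' - err M) ∂μ := by simp
    have hs2 : ∫ x in Ω, τ * (d * β' - err M) ∂μ ≤ ∫ x in Ω, (((ℓ + m : ℕ) : ℝ) *
        (∑ i ∈ Finset.range r, (∑ n ∈ Finset.range M, Ξ i (T^[ℓ * n] x)) / M)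
        + 2 * ((ℓ + m : ℕ) : ℝ) * ε + Z M x) ∂μ :=
      setIntegral_mono_on_ae (integrable_const _) i3.integrableOn hΩ (hmain M hM)
    have hs3 := setIntegral_le_integral (s := Ω) i3 (ae_of_all _ fun x => by
      have : 0 ≤ ∑ i ∈ Finset.range r, (∑ n ∈ Finset.range M, Ξ i (T^[ℓ * n] x)) / M :=
        Finset.sum_nonneg fun i _ => div_nonneg (Finset.sum_nonneg fun n _ => hΞ0 _ _) hM'.le
      have h2 := hZ0 M x
      simp only [Pi.zero_apply]
      positivity)
    rw [integral_add i2 (hZi M), integral_add i1 (integrable_const _), integral_const_mul,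
      integral_finsetSum _ fun i _ =>
        (integrable_finsetSum _ fun n _ => hΞTi i (ℓ * n)).div_const _] at hs3
    have hs4 : ∑ i ∈ Finset.range r, ∫ x, (∑ n ∈ Finset.range M, Ξ i (T^[ℓ * n] x)) / M ∂μ ≤
        r * (η * d) := by
      calc _ ≤ ∑ i ∈ Finset.range r, η * d := Finset.sum_le_sum fun i hi => by
            rw [integral_div, integral_finsetSum _ fun n _ => hΞTi i (ℓ * n)]
            simp only [hΞTe, Finset.sum_const, Finset.card_range, nsmul_eq_mul]
            rw [mul_div_cancel_left₀ _ hM'.ne']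
            exact hΞle i (Finset.mem_range.1 hi)
        _ = _ := by simp
    have hs5 := mul_le_mul_of_nonneg_left hs4 hR'.le
    simp only [integral_const, probReal_univ, smul_eq_mul, one_mul] at hs3
    push_cast at hs2 hs3
    rw [hs1]
    linarith
  have hlim1 : Tendsto (fun M => μ.real Ω * (τ * (d * β' - err M))) atTop
      (𝓝 (μ.real Ω * (τ * (d * β' - 0)))) :=
    ((herr.const_sub _).const_mul _).const_mul _
  have hlim2 : Tendsto (fun M => ((ℓ : ℝ) + m) * (r * (η * d)) + 2 * (ℓ + m) * ε + ∫ x, Z M x ∂μ)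
      atTop (𝓝 (((ℓ : ℝ) + m) * (r * (η * d)) + 2 * (ℓ + m) * ε + 0)) := hZlim.const_add _
  have hfin := le_of_tendsto_of_tendsto hlim1 hlim2
    ((eventually_gt_atTop 0).mono fun M hM => hIntg M hM)
  have e1 : ((ℓ : ℝ) + m) * (r * (η * d)) = τ * d * β' / (4 * ℓ) := by rw [hηd]; field_simp
  have e2 : 2 * ((ℓ : ℝ) + m) * ε = τ * d * β' / (4 * ℓ) := by rw [hεd]; field_simp; norm_num
  rw [e1, e2, sub_zero] at hfin
  have hpos : 0 < τ * d * β' := by positivity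
  have h1 := mul_le_mul_of_nonneg_left hfin hℓ'.le
  have h2 : (ℓ : ℝ) * (τ * d * β' / (4 * ℓ) + τ * d * β' / (4 * ℓ) + 0) = τ * d * β' / 2 := by
    field_simp; ring
  have h3 := mul_le_mul_of_nonneg_right hΩμ hpos.le
  rw [h2] at h1
  have h4 : (ℓ : ℝ) * (μ.real Ω * (τ * (d * β'))) = ℓ * μ.real Ω * (τ * d * β') := by ring
  rw [h4] at h1
  linarith

end corelem


/-- **Dynamical theorem for shifted unrestricted sumsets.** With `q = ⌈m/ℓ⌉` and open sets
`E₁, …, E_{ℓ+m}, F₁, …, F_{ℓ+m}` satisfying `F_j = T^{-(j-1)} F₁`,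
`E_{i+(q+1)} = T^{-1} E_i` and `(ℓ+m) μ(F₁) + ℓ (μ(E₁) + ⋯ + μ(E_{q+1})) > ℓ(q+1)`,
some `j` admits an `(ℓ,m)`-Erdős progression `(a, x₁, x₂)` with `(x₁, x₂) ∈ E_j × F_j`. -/
theorem dynamical_mB_add_lB_unrestricted_shift {X : Type*} [MetricSpace X] [CompactSpace X]
    [MeasurableSpace X] [BorelSpace X]
    (T : X ≃ₜ X) (μ : Measure X) [IsProbabilityMeasure μ]
    (hT : Ergodic (⇑T) μ)
    (a : X) (Φ : ℕ → Finset ℕ) (hΦ : IsFolnerSeq Φ)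
    (ha : GenericAlong (⇑T) μ a Φ)
    (ℓ m : ℕ) (hℓ : 0 < ℓ) (hm : 0 < m)
    (q : ℕ) (hq : q = ⌈(m : ℚ) / ℓ⌉₊)
    (E F : ℕ → Set X)
    (hEopen : ∀ j, 1 ≤ j → j ≤ ℓ + m → IsOpen (E j))
    (hFopen : ∀ j, 1 ≤ j → j ≤ ℓ + m → IsOpen (F j))
    (hF : ∀ j, 1 ≤ j → j ≤ ℓ + m → F j = (⇑T)^[j - 1] ⁻¹' (F 1))
    (hE : ∀ i, 1 ≤ i → i ≤ ℓ + m - q - 1 → E (i + (q + 1)) = ⇑T ⁻¹' (E i))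
    (hineq : ((ℓ : ℝ) + m) * (μ (F 1)).toReal
        + ℓ * (∑ j ∈ Finset.Icc 1 (q + 1), (μ (E j)).toReal) > ℓ * (q + 1)) :
    ∃ j, 1 ≤ j ∧ j ≤ ℓ + m ∧ ∃ x₁ x₂ : X,
      ErdosProg (⇑T) ℓ m a x₁ x₂ ∧ x₁ ∈ E j ∧ x₂ ∈ F j := by
  by_contra hcon
  push Not at hcon
  set R := ℓ + m with hRd
  have hℓq : (0 : ℚ) < ℓ := by exact_mod_cast hℓ
  have hmq : m ≤ q * ℓ := by
    have h1 : (m : ℚ) / ℓ ≤ q := by rw [hq]; exact Nat.le_ceil _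
    rw [div_le_iff₀ hℓq] at h1
    exact_mod_cast h1
  have hqm : q ≤ m := by
    rw [hq, Nat.ceil_le]
    refine div_le_self (Nat.cast_nonneg _) ?_
    exact_mod_cast hℓ
  have hRle : R ≤ (q + 1) * ℓ := by rw [hRd, Nat.add_mul, Nat.one_mul]; omega
  have hTc : Continuous (⇑T) := T.continuous
  have hTm : Measurable (⇑T) := hTc.measurable
  have hF1 : MeasurableSet (F 1) := (hFopen 1 le_rfl (by omega)).measurableSet
  set E0 : ℕ → Set X := fun j => if j < R then E (j + 1) else ∅ with hE0
  have hE0lt : ∀ j, j < R → E0 j = E (j + 1) := fun j hj => by simp [hE0, hj]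
  have hE0m : ∀ j, MeasurableSet (E0 j) := by
    intro j
    by_cases hj : j < R
    · rw [hE0lt j hj]; exact (hEopen _ (by omega) (by omega)).measurableSet
    · simp [hE0, hj]
  have hE0s : ∀ i, i + (q + 1) < R → E0 (i + (q + 1)) = ⇑T ⁻¹' E0 i := by
    intro i hi
    rw [hE0lt _ hi, hE0lt i (by omega), ← hE (i + 1) (by omega) (by omega)]
    congr 1
    omega
  have hsumE : ∑ j ∈ Finset.Icc 1 (q + 1), (μ (E j)).toReal =
      ∑ i ∈ Finset.range (q + 1), μ.real (E0 i) := by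
    rw [← Finset.Ico_add_one_right_eq_Icc, Finset.sum_Ico_eq_sum_range]
    refine Finset.sum_congr (by simp) fun i hi => ?_
    have hi : i < q + 1 := by simpa using hi
    rw [hE0lt i (by omega), Nat.add_comm]
    rfl
  rw [hsumE] at hineq
  set S := ∑ i ∈ Finset.range (q + 1), μ.real (E0 i) with hS
  have hℓ' : (0 : ℝ) < ℓ := by exact_mod_cast hℓ
  have hR' : (0 : ℝ) < (ℓ : ℝ) + m := by positivity
  set β : ℝ := ((ℓ : ℝ) + m) * (μ (F 1)).toReal + ℓ * S - ℓ * (q + 1) with hβ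
  have hβpos : 0 < β := by linarith
  set δ : ℝ := β / (4 * (ℓ + m)) with hδ
  have hδpos : 0 < δ := by positivity
  obtain ⟨F', hF'sub, hF'cl, hF'μ⟩ := hF1.exists_isClosed_lt_add (measure_ne_top μ _)
    (ENNReal.ofReal_pos.2 hδpos).ne'
  have hF'r : (μ (F 1)).toReal ≤ μ.real F' + δ := by
    have h1 := ENNReal.toReal_mono (by finiteness) hF'μ.le
    rwa [ENNReal.toReal_add (measure_ne_top _ _) ENNReal.ofReal_ne_top,
      ENNReal.toReal_ofReal hδpos.le] at h1
  set Bad : ℕ → Set X := fun k => ⋃ N, ⋃ (_ : N ≥ k), ⋃ j, ⋃ (_ : j < R),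
    ({y | dist ((⇑T)^[ℓ * N] a) y < 1 / ((k : ℝ) + 1)} ∩ E0 j ∩ (⇑T)^[m * N + j] ⁻¹' F') with hBad
  have hBadmem : ∀ k y, y ∈ Bad k ↔ ∃ N ≥ k, dist ((⇑T)^[ℓ * N] a) y < 1 / ((k : ℝ) + 1) ∧
      ∃ j < R, y ∈ E0 j ∧ (⇑T)^[m * N + j] y ∈ F' := by
    intro k y
    simp only [hBad, Set.mem_iUnion]
    constructor
    · rintro ⟨N, hN, j, hj, ⟨h1, h2⟩, h3⟩
      exact ⟨N, hN, h1, j, hj, h2, h3⟩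
    · rintro ⟨N, hN, h1, j, hj, h2, h3⟩
      exact ⟨N, hN, j, hj, ⟨h1, h2⟩, h3⟩
  have hBadm : ∀ k, MeasurableSet (Bad k) := by
    intro k
    refine MeasurableSet.iUnion fun N => MeasurableSet.iUnion fun _ => MeasurableSet.iUnion fun j =>
      MeasurableSet.iUnion fun _ => (MeasurableSet.inter ?_ (hE0m j)).inter ?_
    · exact (isOpen_lt (by fun_prop) continuous_const).measurableSet
    · exact (hTm.iterate _) hF'cl.measurableSet
  have hanti : Antitone Bad := by
    intro k k' hkk y hy
    obtain ⟨N, hN, h1, h2⟩ := (hBadmem k' y).1 hy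
    refine (hBadmem k y).2 ⟨N, hkk.trans hN, h1.trans_le ?_, h2⟩
    have : (k : ℝ) ≤ k' := by exact_mod_cast hkk
    exact one_div_le_one_div_of_le (by positivity) (by linarith)
  have hempty : ⋂ k, Bad k = ∅ := by
    rw [Set.eq_empty_iff_forall_notMem]
    intro y hy
    rw [Set.mem_iInter] at hy
    obtain ⟨j, hj, x₂, hprog, hyE, hx₂⟩ := exists_prog hTc a y ℓ m R E0 F' hF'cl
      fun k => (hBadmem k y).1 (hy k)
    rw [hE0lt j hj] at hyE
    refine hcon (j + 1) (by omega) (by omega) y x₂ hprog hyE ?_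
    rw [hF (j + 1) (by omega) (by omega)]
    exact hF'sub hx₂
  have hlim : Tendsto (fun k => μ.real (Bad k)) atTop (𝓝 0) := by
    have h1 := tendsto_measure_iInter_atTop (μ := μ) (fun k => (hBadm k).nullMeasurableSet) hanti
      ⟨0, measure_ne_top _ _⟩
    rw [hempty, measure_empty] at h1
    exact (ENNReal.tendsto_toReal ENNReal.zero_ne_top).comp h1
  have hσ : 0 < β / (4 * ((ℓ + m) * ℓ)) := by positivity
  obtain ⟨k, hk⟩ := (hlim.eventually (gt_mem_nhds hσ)).exists
  refine core hTc hT hΦ ha ℓ m (q + 1) hℓ (Nat.succ_pos q) hRle E0 hE0s hE0m F' (Bad k)ᶜ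
    hF'cl.measurableSet (hBadm k).compl k (1 / (2 * ((k : ℝ) + 1))) (by positivity) ?_ ?_
  · intro y hy N hN hd j hj hyE hF'mem
    refine hy ((hBadmem k y).2 ⟨N, hN, ?_, j, hj, hyE, ?_⟩)
    · have e : 2 * (1 / (2 * ((k : ℝ) + 1))) = 1 / ((k : ℝ) + 1) := by field_simp
      rwa [e] at hd
    · rwa [Nat.add_comm, Function.iterate_add_apply]
  · rw [compl_compl, ← hS]
    have h1 : ((ℓ : ℝ) + m) * ℓ * μ.real (Bad k) ≤ β / 4 := by
      have e : ((ℓ : ℝ) + m) * ℓ * (β / (4 * ((ℓ + m) * ℓ))) = β / 4 := by field_simp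
      rw [← e]
      gcongr
    have h2 := mul_le_mul_of_nonneg_left hF'r hR'.le
    have e2 : ((ℓ : ℝ) + m) * δ = β / 4 := by rw [hδ]; field_simp
    rw [mul_add, e2] at h2
    push_cast
    linarith
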